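/- arXiv:2405.08147 — 6 statements merged into one kernel-verified Lean document; each statement's English description precedes it below -/
import Mathlib

section
/- Let m = 1 or m = 2, and let u ∈ (ℤ[1/3, ω])^m be a vector with Σ_{j=1}^m |u_j|² = 1. Then sde(u) = 0; that is, all entries of u lie in ℤ[ω]. -/
theorem sq_add_sq_three (a c : ℤ) (h : (3:ℤ) ∣ a ^ 2 + c ^ 2) : (3:ℤ) ∣ a ∧ (3:ℤ) ∣ c := by
  have ha : a % 3 = 0 ∨ a % 3 = 1 ∨ a % 3 = 2 := by omega
  have hc : c % 3 = 0 ∨ c % 3 = 1 ∨ c % 3 = 2 := by omega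
  have h' := Int.emod_eq_zero_of_dvd h
  rcases ha with ha | ha | ha <;> rcases hc with hc | hc | hc <;>
    simp [pow_two, Int.add_emod, Int.mul_emod, ha, hc] at h' <;> omega

theorem descent_step (a b c d : ℤ)
    (h : (9:ℤ) ∣ a ^ 2 - a * b + b ^ 2 + (c ^ 2 - c * d + d ^ 2)) :
    ((3:ℤ) ∣ a ∧ (3:ℤ) ∣ b) ∧ ((3:ℤ) ∣ c ∧ (3:ℤ) ∣ d) := by
  obtain ⟨t, ht⟩ := h
  obtain ⟨⟨s, hs⟩, ⟨r, hr⟩⟩ := sq_add_sq_three (a + b) (c + d)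
    ⟨3 * t + a * b + c * d, by linarith⟩
  obtain rfl : b = 3 * s - a := by linarith
  obtain rfl : d = 3 * r - c := by linarith
  obtain ⟨⟨x, rfl⟩, ⟨y, rfl⟩⟩ := sq_add_sq_three a c
    ⟨t + a * s - s ^ 2 + c * r - r ^ 2, by linarith⟩
  refine ⟨⟨⟨x, rfl⟩, ⟨s - x, by ring⟩⟩, ⟨⟨y, rfl⟩, ⟨r - y, by ring⟩⟩⟩

theorem descent (k : ℕ) : ∀ a b c d : ℤ,
    a ^ 2 - a * b + b ^ 2 + (c ^ 2 - c * d + d ^ 2) = 9 ^ k →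
    ((3:ℤ) ^ k ∣ a ∧ (3:ℤ) ^ k ∣ b) ∧ ((3:ℤ) ^ k ∣ c ∧ (3:ℤ) ^ k ∣ d) := by
  induction k with
  | zero => intros; simp
  | succ k ih =>
    intro a b c d h
    obtain ⟨⟨⟨a, rfl⟩, ⟨b, rfl⟩⟩, ⟨⟨c, rfl⟩, ⟨d, rfl⟩⟩⟩ :=
      descent_step a b c d ⟨9 ^ k, by rw [h]; ring⟩
    obtain ⟨⟨ha, hb⟩, hc, hd⟩ := ih a b c d (by rw [pow_succ 9 k] at h; linarith)
    simp only [pow_succ']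
    exact ⟨⟨mul_dvd_mul_left _ ha, mul_dvd_mul_left _ hb⟩,
      mul_dvd_mul_left _ hc, mul_dvd_mul_left _ hd⟩

theorem closure_form (ω : ℂ) (h : ω ^ 2 = -1 - ω) (x : ℂ)
    (hx : x ∈ Subring.closure {(3 : ℂ)⁻¹, ω}) :
    ∃ (k : ℕ) (a b : ℤ), 3 ^ k * x = a + b * ω := by
  induction hx using Subring.closure_induction with
  | mem x hx =>
    rcases hx with rfl | rfl
    · exact ⟨1, 1, 0, by norm_num⟩
    · exact ⟨0, 0, 1, by norm_num⟩
  | zero => exact ⟨0, 0, 0, by norm_num⟩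
  | one => exact ⟨0, 1, 0, by norm_num⟩
  | add x y _ _ hx hy =>
    obtain ⟨k, a, b, e⟩ := hx
    obtain ⟨l, c, d, f⟩ := hy
    refine ⟨k + l, 3 ^ l * a + 3 ^ k * c, 3 ^ l * b + 3 ^ k * d, ?_⟩
    push_cast
    linear_combination 3 ^ l * e + 3 ^ k * f
  | neg x _ hx =>
    obtain ⟨k, a, b, e⟩ := hx
    refine ⟨k, -a, -b, ?_⟩
    push_cast
    linear_combination -e
  | mul x y _ _ hx hy =>
    obtain ⟨k, a, b, e⟩ := hx
    obtain ⟨l, c, d, f⟩ := hy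
    refine ⟨k + l, a * c - b * d, a * d + b * c - b * d, ?_⟩
    push_cast
    linear_combination 3 ^ l * y * e + (a + b * ω) * f + b * d * h

theorem pair_case (ω : ℂ) (h : ω ^ 2 = -1 - ω) (hc : (starRingEnd ℂ) ω = -1 - ω) (x y : ℂ)
    (hx : x ∈ Subring.closure {(3 : ℂ)⁻¹, ω}) (hy : y ∈ Subring.closure {(3 : ℂ)⁻¹, ω})
    (hn : x * (starRingEnd ℂ) x + y * (starRingEnd ℂ) y = 1) :
    x ∈ Subring.closure {ω} ∧ y ∈ Subring.closure {ω} := by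
  obtain ⟨k, a, b, e⟩ := closure_form ω h x hx
  obtain ⟨l, c, d, f⟩ := closure_form ω h y hy
  have e' := congrArg (starRingEnd ℂ) e
  have f' := congrArg (starRingEnd ℂ) f
  simp only [map_mul, map_add, map_pow, map_ofNat, map_intCast, hc] at e' f'
  have key : ((3 ^ l * a) ^ 2 - (3 ^ l * a) * (3 ^ l * b) + (3 ^ l * b) ^ 2
      + ((3 ^ k * c) ^ 2 - (3 ^ k * c) * (3 ^ k * d) + (3 ^ k * d) ^ 2) : ℤ) = 9 ^ (k + l) := by
    have h9 : (9:ℂ) ^ (k + l) = (3 ^ k) ^ 2 * (3 ^ l) ^ 2 := by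
      rw [← mul_pow, ← pow_add, ← pow_mul, mul_comm, pow_mul]; norm_num
    have : (((3 ^ l * a) ^ 2 - (3 ^ l * a) * (3 ^ l * b) + (3 ^ l * b) ^ 2
      + ((3 ^ k * c) ^ 2 - (3 ^ k * c) * (3 ^ k * d) + (3 ^ k * d) ^ 2) : ℤ) : ℂ)
        = ((9 ^ (k + l) : ℤ) : ℂ) := by
      push_cast
      rw [h9]
      have E : (3 ^ k * x) * (3 ^ k * (starRingEnd ℂ) x) = (a:ℂ) ^ 2 - a * b + b ^ 2 := by
        rw [e, e']; linear_combination -(b:ℂ) ^ 2 * h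
      have F : (3 ^ l * y) * (3 ^ l * (starRingEnd ℂ) y) = (c:ℂ) ^ 2 - c * d + d ^ 2 := by
        rw [f, f']; linear_combination -(d:ℂ) ^ 2 * h
      linear_combination -(3 ^ l) ^ 2 * E - (3 ^ k) ^ 2 * F + (3 ^ k) ^ 2 * (3 ^ l) ^ 2 * hn
    exact_mod_cast this
  obtain ⟨⟨⟨a', ha⟩, ⟨b', hb⟩⟩, ⟨c', hc'⟩, ⟨d', hd⟩⟩ := descent _ _ _ _ _ key
  have h3 : (3:ℂ) ^ (k + l) ≠ 0 := pow_ne_zero _ (by norm_num)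
  have mem : ∀ p q : ℤ, (p + q * ω : ℂ) ∈ Subring.closure {ω} := fun p q =>
    add_mem (intCast_mem _ p) (mul_mem (intCast_mem _ q) (Subring.subset_closure rfl))
  have ha := congrArg (Int.cast : ℤ → ℂ) ha
  have hb := congrArg (Int.cast : ℤ → ℂ) hb
  have hc' := congrArg (Int.cast : ℤ → ℂ) hc'
  have hd := congrArg (Int.cast : ℤ → ℂ) hd
  push_cast at ha hb hc' hd
  have X : x = a' + b' * ω := by
    apply mul_left_cancel₀ h3
    linear_combination 3 ^ l * e + ha + ω * hb
  have Y : y = c' + d' * ω := by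
    apply mul_left_cancel₀ h3
    linear_combination 3 ^ k * f + hc' + ω * hd
  rw [X, Y]
  exact ⟨mem _ _, mem _ _⟩

/-- For `m = 1` or `m = 2`, any unit vector `u ∈ (ℤ[1/3, ω])^m`
(`ω = e^{2πi/3}`) has `sde(u) = 0`, i.e. all its entries already lie in `ℤ[ω]`. -/
theorem short_unit_vector_has_sde_zero
    (m : ℕ) (hm : m = 1 ∨ m = 2)
    (ω : ℂ) (hω : ω = Complex.exp (2 * Real.pi * Complex.I / 3))
    (u : Fin m → ℂ) (hu : ∀ j, u j ∈ Subring.closure {(3 : ℂ)⁻¹, ω})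
    (hnorm : ∑ j, u j * (starRingEnd ℂ) (u j) = 1) :
    ∀ j, u j ∈ Subring.closure {ω} := by
  have hp : IsPrimitiveRoot ω 3 := by
    rw [hω]; exact_mod_cast Complex.isPrimitiveRoot_exp 3 (by norm_num)
  have h : ω ^ 2 = -1 - ω := by
    have h0 := hp.geom_sum_eq_zero (by norm_num)
    simp [Finset.sum_range_succ] at h0
    linear_combination h0
  have h1 : ω ^ 3 = 1 := hp.pow_eq_one
  have hc : (starRingEnd ℂ) ω = -1 - ω := by
    have hn : ‖ω‖ = 1 := hp.norm'_eq_one (by norm_num)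
    have h2 : ω * (starRingEnd ℂ) ω = 1 := by
      rw [Complex.mul_conj, Complex.normSq_eq_norm_sq, hn]; norm_num
    rw [← h]
    linear_combination ω ^ 2 * h2 - (starRingEnd ℂ) ω * h1
  rcases hm with rfl | rfl
  · have := pair_case ω h hc (u 0) 0 (hu 0) (zero_mem _) (by simpa using hnorm)
    intro j
    fin_cases j
    exact this.1
  · have := pair_case ω h hc (u 0) (u 1) (hu 0) (hu 1) (by simpa [Fin.sum_univ_two] using hnorm)
    intro j
    fin_cases j
    exacts [this.1, this.2]
end

section
/- Let m = 1 or m = 2, and let u ∈ (ℤ[1/3, ω])^m be a vector with Σ_{j=1}^m |u_j|² = 1. Then there exists a finite sequence U_1, …, U_k of m×m matrices, each of which is either a 2-level matrix of type [[0,1],[1,0]] (only when m = 2) or a 1-level matrix of type ω or of type −1, such that U_1 U_2 ⋯ U_k u equals (1)^T when m = 1, and equals (1, 0)^T when m = 2. -/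
/-- The 1-level matrix `[a]_{[j]}` of type `a`: the identity matrix with its `(j,j)` entry
replaced by `a`. -/
def IsOneLevel {m : ℕ} (a : ℂ) (M : Matrix (Fin m) (Fin m) ℂ) : Prop :=
  ∃ j : Fin m, M = Matrix.of fun i i' =>
    if i = i' then (if i = j then a else 1) else (0 : ℂ)

/-- The 2-level matrix `V_{[j,l]}` of type `V ∈ M₂(ℂ)`: the identity matrix except that the
entries at `(j,j), (j,l), (l,j), (l,l)` are `V₁₁, V₁₂, V₂₁, V₂₂`. -/
def IsTwoLevel {m : ℕ} (V : Matrix (Fin 2) (Fin 2) ℂ) (M : Matrix (Fin m) (Fin m) ℂ) : Prop :=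
  ∃ j l : Fin m, j ≠ l ∧ M = Matrix.of fun i i' =>
    if i = j ∧ i' = j then V 0 0
    else if i = j ∧ i' = l then V 0 1
    else if i = l ∧ i' = j then V 1 0
    else if i = l ∧ i' = l then V 1 1
    else if i = i' then 1 else (0 : ℂ)

lemma aux_omega (ω : ℂ) (hω : ω = Complex.exp (2 * Real.pi * Complex.I / 3)) :
    ω ^ 2 = -1 - ω ∧ (starRingEnd ℂ) ω = -1 - ω := by
  have h3 : (Real.sqrt 3) ^ 2 = 3 := Real.sq_sqrt (by norm_num)
  have e : ω = ⟨-1/2, Real.sqrt 3 / 2⟩ := by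
    have h1 : (2 * Real.pi * Complex.I / 3 : ℂ) = ((Real.pi - Real.pi / 3 : ℝ) : ℂ) * Complex.I := by
      push_cast; ring
    rw [hω, h1]
    apply Complex.ext
    · rw [Complex.exp_ofReal_mul_I_re, Real.cos_pi_sub, Real.cos_pi_div_three]; norm_num
    · rw [Complex.exp_ofReal_mul_I_im, Real.sin_pi_sub, Real.sin_pi_div_three]
  rw [e]
  constructor
  · apply Complex.ext
    · simp [pow_two]; nlinarith
    · simp [pow_two]; ring
  · apply Complex.ext
    · simp; norm_num
    · simp

lemma aux_closure (ω : ℂ) (h2 : ω ^ 2 = -1 - ω) (z : ℂ)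
    (hz : z ∈ Subring.closure {(3 : ℂ)⁻¹, ω}) :
    ∃ (k : ℕ) (a b : ℤ), z * 3 ^ k = a + b * ω := by
  induction hz using Subring.closure_induction with
  | mem x hx =>
    rcases hx with rfl | hx
    · exact ⟨1, 1, 0, by norm_num⟩
    · rw [Set.mem_singleton_iff] at hx
      subst hx
      exact ⟨0, 0, 1, by simp⟩
  | zero => exact ⟨0, 0, 0, by simp⟩
  | one => exact ⟨0, 1, 0, by simp⟩
  | add x y _ _ hx hy =>
    obtain ⟨k, a, b, hx⟩ := hx
    obtain ⟨l, c, d, hy⟩ := hy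
    refine ⟨k + l, a * 3 ^ l + c * 3 ^ k, b * 3 ^ l + d * 3 ^ k, ?_⟩
    push_cast
    rw [pow_add]
    linear_combination (3 : ℂ) ^ l * hx + (3 : ℂ) ^ k * hy
  | neg x _ hx =>
    obtain ⟨k, a, b, hx⟩ := hx
    refine ⟨k, -a, -b, ?_⟩
    push_cast
    linear_combination -hx
  | mul x y _ _ hx hy =>
    obtain ⟨k, a, b, hx⟩ := hx
    obtain ⟨l, c, d, hy⟩ := hy
    refine ⟨k + l, a * c - b * d, a * d + b * c - b * d, ?_⟩
    push_cast
    rw [pow_add]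
    linear_combination (y * 3 ^ l) * hx + (a + b * ω) * hy + b * d * h2

lemma aux_sq (x y : ℤ) (h : 3 ∣ x ^ 2 + y ^ 2) : 3 ∣ x ∧ 3 ∣ y := by
  have key : ∀ p q : ZMod 3, p ^ 2 + q ^ 2 = 0 → p = 0 ∧ q = 0 := by decide
  have := key x y (by
    have := (ZMod.intCast_zmod_eq_zero_iff_dvd (x ^ 2 + y ^ 2) 3).2 (by exact_mod_cast h)
    push_cast at this; exact this)
  constructor
  · exact_mod_cast (ZMod.intCast_zmod_eq_zero_iff_dvd x 3).1 this.1
  · exact_mod_cast (ZMod.intCast_zmod_eq_zero_iff_dvd y 3).1 this.2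

lemma aux_descent (k : ℕ) : ∀ a b c d : ℤ,
    (a ^ 2 - a * b + b ^ 2) + (c ^ 2 - c * d + d ^ 2) = 9 ^ k →
    ∃ a' b' c' d' : ℤ, a = 3 ^ k * a' ∧ b = 3 ^ k * b' ∧ c = 3 ^ k * c' ∧ d = 3 ^ k * d' ∧
      (a' ^ 2 - a' * b' + b' ^ 2) + (c' ^ 2 - c' * d' + d' ^ 2) = 1 := by
  induction k with
  | zero => intro a b c d h; exact ⟨a, b, c, d, by simp, by simp, by simp, by simp, by simpa using h⟩
  | succ k ih =>
    intro a b c d h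
    rw [pow_succ (9 : ℤ) k] at h
    obtain ⟨⟨p, hp⟩, ⟨q, hq⟩⟩ := aux_sq (a + b) (c + d)
      ⟨9 ^ k * 3 + a * b + c * d, by linear_combination h⟩
    obtain rfl : b = 3 * p - a := by linarith
    obtain rfl : d = 3 * q - c := by linarith
    obtain ⟨⟨a, rfl⟩, ⟨c, rfl⟩⟩ := aux_sq a c
      ⟨9 ^ k - p ^ 2 - q ^ 2 + a * p + c * q, by linarith⟩
    obtain ⟨a', b', c', d', h1, h2, h3, h4, h5⟩ := ih a (p - a) c (q - c) (by linarith)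
    refine ⟨a', b', c', d', ?_, ?_, ?_, ?_, h5⟩ <;> rw [pow_succ] <;> linarith

lemma aux_zero (a b : ℤ) (h : a ^ 2 - a * b + b ^ 2 = 0) : a = 0 ∧ b = 0 := by
  constructor
  · have : a ^ 2 = 0 := by nlinarith [sq_nonneg a, sq_nonneg (a - 2 * b)]
    simpa using this
  · have : b ^ 2 = 0 := by nlinarith [sq_nonneg b, sq_nonneg (b - 2 * a)]
    simpa using this

lemma aux_unit (ω : ℂ) (h2 : ω ^ 2 = -1 - ω) (a b : ℤ) (h : a ^ 2 - a * b + b ^ 2 = 1) :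
    ∃ e f : ℕ, (-1) ^ e * (ω ^ f * ((a : ℂ) + b * ω)) = 1 := by
  have ha : a ≤ 1 := by nlinarith [sq_nonneg (a - 2 * b)]
  have ha' : -1 ≤ a := by nlinarith [sq_nonneg (a - 2 * b)]
  have hb : b ≤ 1 := by nlinarith [sq_nonneg (b - 2 * a)]
  have hb' : -1 ≤ b := by nlinarith [sq_nonneg (b - 2 * a)]
  interval_cases a <;> interval_cases b <;> first | (exfalso; revert h; norm_num; done) | skip
  · exact ⟨0, 1, by push_cast; linear_combination -h2⟩
  · exact ⟨1, 0, by push_cast; ring⟩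
  · exact ⟨1, 2, by push_cast; linear_combination (ω - 1) * h2⟩
  · exact ⟨0, 2, by push_cast; linear_combination (ω - 1) * h2⟩
  · exact ⟨0, 0, by push_cast; ring⟩
  · exact ⟨1, 1, by push_cast; linear_combination -h2⟩

def AuxR (ω : ℂ) {m : ℕ} (u : Fin m → ℂ) : Prop :=
  ∃ Us : List (Matrix (Fin m) (Fin m) ℂ),
      (∀ M ∈ Us, IsTwoLevel !![0, 1; 1, 0] M ∨ IsOneLevel ω M ∨ IsOneLevel (-1) M) ∧
      Us.prod.mulVec u = fun i : Fin m => if (i : ℕ) = 0 then 1 else 0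

lemma AuxR.step {ω : ℂ} {m : ℕ} {u v : Fin m → ℂ} (M : Matrix (Fin m) (Fin m) ℂ)
    (hM : IsTwoLevel !![0, 1; 1, 0] M ∨ IsOneLevel ω M ∨ IsOneLevel (-1) M)
    (h : AuxR ω v) (hv : M.mulVec u = v) : AuxR ω u := by
  obtain ⟨Us, h1, h2⟩ := h
  refine ⟨Us ++ [M], ?_, ?_⟩
  · intro N hN
    rcases List.mem_append.1 hN with h | h
    · exact h1 N h
    · rw [List.mem_singleton] at h; rwa [h]
  · rw [List.prod_append, List.prod_singleton, ← Matrix.mulVec_mulVec, hv, h2]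

lemma AuxR.one {ω a : ℂ} (ha : a = ω ∨ a = -1) {m : ℕ} (j : Fin m) (z : ℂ)
    (h : AuxR ω (Pi.single j (a * z))) : AuxR ω (Pi.single j z) := by
  refine h.step (Matrix.of fun i i' =>
    if i = i' then (if i = j then a else 1) else (0 : ℂ)) ?_ ?_
  · rcases ha with rfl | rfl
    · exact Or.inr (Or.inl ⟨j, rfl⟩)
    · exact Or.inr (Or.inr ⟨j, rfl⟩)
  · ext i
    rw [Matrix.mulVec_single]
    by_cases hij : i = j
    · subst hij; simp [mul_comm]
    · simp [hij]

lemma AuxR.pow {ω a : ℂ} (ha : a = ω ∨ a = -1) {m : ℕ} (j : Fin m) (n : ℕ) : ∀ (z : ℂ)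
    (_ : AuxR ω (Pi.single j (a ^ n * z))), AuxR ω (Pi.single j z) := by
  induction n with
  | zero => intro z h; simpa using h
  | succ n ih =>
    intro z h
    apply AuxR.one ha
    apply ih
    rwa [← mul_assoc, ← pow_succ]

lemma AuxR.unit {ω : ℂ} (h2 : ω ^ 2 = -1 - ω) {m : ℕ} (j : Fin m) (a b : ℤ)
    (h : a ^ 2 - a * b + b ^ 2 = 1) (h1 : AuxR ω (Pi.single j (1 : ℂ))) :
    AuxR ω (Pi.single j ((a : ℂ) + b * ω)) := by
  obtain ⟨e, f, hh⟩ := aux_unit ω h2 a b h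
  apply AuxR.pow (Or.inl rfl) j f
  apply AuxR.pow (Or.inr rfl) j e
  rwa [hh]

lemma AuxR.base0 {ω : ℂ} {m : ℕ} [NeZero m] : AuxR ω (Pi.single (0 : Fin m) (1 : ℂ)) := by
  refine ⟨[], by simp, ?_⟩
  ext i
  simp only [List.prod_nil, Matrix.one_mulVec, Pi.single_apply, Fin.ext_iff, Fin.val_zero]

lemma AuxR.base1 {ω : ℂ} : AuxR ω (Pi.single (1 : Fin 2) (1 : ℂ)) := by
  refine (AuxR.base0 (m := 2)).step _ (Or.inl ⟨0, 1, by decide, rfl⟩) ?_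
  ext i
  rw [Matrix.mulVec_single]
  fin_cases i <;> simp

/-- Two Eisenstein-type numbers with squared moduli adding to one. -/
lemma aux_pair (ω : ℂ) (h2 : ω ^ 2 = -1 - ω) (hc : (starRingEnd ℂ) ω = -1 - ω) (x y : ℂ)
    (hx : x ∈ Subring.closure {(3 : ℂ)⁻¹, ω}) (hy : y ∈ Subring.closure {(3 : ℂ)⁻¹, ω})
    (h : x * (starRingEnd ℂ) x + y * (starRingEnd ℂ) y = 1) :
    (y = 0 ∧ ∃ a b : ℤ, x = a + b * ω ∧ a ^ 2 - a * b + b ^ 2 = 1) ∨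
    (x = 0 ∧ ∃ a b : ℤ, y = a + b * ω ∧ a ^ 2 - a * b + b ^ 2 = 1) := by
  obtain ⟨k, a, b, hx⟩ := aux_closure ω h2 x hx
  obtain ⟨l, c, d, hy⟩ := aux_closure ω h2 y hy
  have hX : x * 3 ^ (k + l) = ((a * 3 ^ l : ℤ) : ℂ) + ((b * 3 ^ l : ℤ) : ℂ) * ω := by
    push_cast; rw [pow_add]; linear_combination (3 : ℂ) ^ l * hx
  have hY : y * 3 ^ (k + l) = ((c * 3 ^ k : ℤ) : ℂ) + ((d * 3 ^ k : ℤ) : ℂ) * ω := by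
    push_cast; rw [pow_add]; linear_combination (3 : ℂ) ^ k * hy
  generalize a * 3 ^ l = a at hX
  generalize b * 3 ^ l = b at hX
  generalize c * 3 ^ k = c at hY
  generalize d * 3 ^ k = d at hY
  generalize k + l = n at hX hY
  have hX' := congrArg (starRingEnd ℂ) hX
  have hY' := congrArg (starRingEnd ℂ) hY
  simp only [map_mul, map_add, map_pow, hc, map_intCast, map_ofNat] at hX' hY'
  have hC : (((a ^ 2 - a * b + b ^ 2) + (c ^ 2 - c * d + d ^ 2) : ℤ) : ℂ) = ((9 ^ n : ℤ) : ℂ) := by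
    have h9 : (9 : ℂ) ^ n = 3 ^ n * 3 ^ n := by rw [← mul_pow]; norm_num
    push_cast
    rw [h9]
    linear_combination (3 ^ n * 3 ^ n : ℂ) * h - ((starRingEnd ℂ) x * 3 ^ n) * hX
      - (a + b * ω) * hX' - ((starRingEnd ℂ) y * 3 ^ n) * hY - (c + d * ω) * hY'
      + (b ^ 2 + d ^ 2) * h2
  obtain ⟨a', b', c', d', rfl, rfl, rfl, rfl, h5⟩ := aux_descent n a b c d (by exact_mod_cast hC)
  have h3 : (3 : ℂ) ^ n ≠ 0 := pow_ne_zero _ (by norm_num)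
  have hx1 : x = a' + b' * ω := by
    apply mul_right_cancel₀ h3; rw [hX]; push_cast; ring
  have hy1 : y = c' + d' * ω := by
    apply mul_right_cancel₀ h3; rw [hY]; push_cast; ring
  have p1 : 0 ≤ a' ^ 2 - a' * b' + b' ^ 2 := by nlinarith [sq_nonneg (a' - b'), sq_nonneg (a' + b')]
  have p2 : 0 ≤ c' ^ 2 - c' * d' + d' ^ 2 := by nlinarith [sq_nonneg (c' - d'), sq_nonneg (c' + d')]
  have : c' ^ 2 - c' * d' + d' ^ 2 = 0 ∨ a' ^ 2 - a' * b' + b' ^ 2 = 0 := by lia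
  rcases this with h0 | h0
  · left
    obtain ⟨rfl, rfl⟩ := aux_zero _ _ h0
    exact ⟨by simp [hy1], a', b', hx1, by linarith⟩
  · right
    obtain ⟨rfl, rfl⟩ := aux_zero _ _ h0
    exact ⟨by simp [hx1], c', d', hy1, by linarith⟩

/-- For `m = 1` or `m = 2` and a unit vector `u ∈ (ℤ[1/3, ω])^m`, there is a
finite sequence of `m×m` matrices, each a 2-level matrix of type `[[0,1],[1,0]]` or a 1-level
matrix of type `ω` or `−1`, whose product maps `u` to `(1)ᵀ` (for `m = 1`) resp. `(1,0)ᵀ`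
(for `m = 2`), i.e. to the first standard basis vector. -/
theorem short_unit_vector_reduction
    (m : ℕ) (hm : m = 1 ∨ m = 2)
    (ω : ℂ) (hω : ω = Complex.exp (2 * Real.pi * Complex.I / 3))
    (u : Fin m → ℂ) (hu : ∀ j, u j ∈ Subring.closure {(3 : ℂ)⁻¹, ω})
    (hnorm : ∑ j, u j * (starRingEnd ℂ) (u j) = 1) :
    ∃ Us : List (Matrix (Fin m) (Fin m) ℂ),
      (∀ M ∈ Us, IsTwoLevel !![0, 1; 1, 0] M ∨ IsOneLevel ω M ∨ IsOneLevel (-1) M) ∧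
      Us.prod.mulVec u = fun i : Fin m => if (i : ℕ) = 0 then 1 else 0 := by

  obtain ⟨h2, hc⟩ := aux_omega ω hω
  change AuxR ω u
  rcases hm with rfl | rfl
  · rw [Fin.sum_univ_one] at hnorm
    rcases aux_pair ω h2 hc (u 0) 0 (hu 0) (Subring.zero_mem _) (by simpa using hnorm) with
      ⟨-, a, b, h, hn⟩ | ⟨h, -⟩
    · have : u = Pi.single 0 ((a : ℂ) + b * ω) := by
        ext i; fin_cases i; simpa using h
      rw [this]
      exact AuxR.unit h2 0 a b hn AuxR.base0
    · simp [h] at hnorm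
  · rw [Fin.sum_univ_two] at hnorm
    rcases aux_pair ω h2 hc (u 0) (u 1) (hu 0) (hu 1) hnorm with
      ⟨h0, a, b, h, hn⟩ | ⟨h0, a, b, h, hn⟩
    · have : u = Pi.single 0 ((a : ℂ) + b * ω) := by
        ext i; fin_cases i
        · simpa using h
        · simpa using h0
      rw [this]
      exact AuxR.unit h2 0 a b hn AuxR.base0
    · have : u = Pi.single 1 ((a : ℂ) + b * ω) := by
        ext i; fin_cases i
        · simpa using h0
        · simpa using h
      rw [this]
      exact AuxR.unit h2 1 a b hn AuxR.base1
end

section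
/- Let g ∈ ℤ[X] be a polynomial with integer coefficients, and let g' denote its formal derivative. Then: (i) g(ω) ∈ (1−ω)·ℤ[ω] if and only if g(1) ≡ 0 (mod 3); and (ii) g(ω) ∈ (1−ω)²·ℤ[ω] if and only if g(1) ≡ 0 (mod 3) and g'(1) ≡ 0 (mod 3). -/
theorem aux_decomp (g : Polynomial ℤ) : ∃ q : Polynomial ℤ,
    g = (Polynomial.X - 1) ^ 2 * q + Polynomial.C (g.derivative.eval 1) * (Polynomial.X - 1)
      + Polynomial.C (g.eval 1) := by
  obtain ⟨p, hp⟩ := Polynomial.X_sub_C_dvd_sub_C_eval (a := (1 : ℤ)) (p := g)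
  obtain ⟨q, hq⟩ := Polynomial.X_sub_C_dvd_sub_C_eval (a := (1 : ℤ)) (p := p)
  have hd : g.derivative.eval 1 = p.eval 1 := by
    have := congrArg (fun r => (Polynomial.derivative r).eval 1) hp
    simpa using this
  refine ⟨q, ?_⟩
  rw [hd]
  simp only [map_one] at hp hq
  linear_combination hp + (Polynomial.X - 1) * hq

/-- For `g ∈ ℤ[X]` with formal derivative `g'`, and `ω = e^{2πi/3}`:
(i) `g(ω) ∈ (1−ω)·ℤ[ω]` iff `3 ∣ g(1)`; and
(ii) `g(ω) ∈ (1−ω)²·ℤ[ω]` iff `3 ∣ g(1)` and `3 ∣ g'(1)`. -/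
theorem derivative_mod_three_criterion
    (ω : ℂ) (hω : ω = Complex.exp (2 * Real.pi * Complex.I / 3))
    (g : Polynomial ℤ) :
    ((∃ y ∈ Subring.closure {ω}, Polynomial.aeval ω g = (1 - ω) * y) ↔
      (3 : ℤ) ∣ g.eval 1) ∧
    ((∃ y ∈ Subring.closure {ω}, Polynomial.aeval ω g = (1 - ω) ^ 2 * y) ↔
      ((3 : ℤ) ∣ g.eval 1 ∧ (3 : ℤ) ∣ g.derivative.eval 1)) := by
  have him : ω.im ≠ 0 := by
    have e : (2 * Real.pi * Complex.I / 3 : ℂ) = ((2 * Real.pi / 3 : ℝ) : ℂ) * Complex.I := by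
      push_cast; ring
    rw [hω, e, Complex.exp_ofReal_mul_I_im]
    apply ne_of_gt
    apply Real.sin_pos_of_pos_of_lt_pi <;> linarith [Real.pi_pos]
  have h3 : ω ^ 3 = 1 := by
    rw [hω, ← Complex.exp_nat_mul, ← Complex.exp_two_pi_mul_I]
    congr 1; push_cast; ring
  have hne : ω - 1 ≠ 0 := by
    intro h
    apply him
    rw [sub_eq_zero.mp h]; simp
  have h2 : ω ^ 2 + ω + 1 = 0 := by
    apply mul_left_cancel₀ hne
    linear_combination h3
  have hind : ∀ a b : ℤ, (a : ℂ) + b * ω = 0 → a = 0 ∧ b = 0 := by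
    intro a b h
    have hb : b = 0 := by
      have := congrArg Complex.im h
      simpa [him] using this
    subst hb
    exact ⟨by simpa using h, rfl⟩
  have hmω : ω ∈ Subring.closure {ω} := Subring.subset_closure rfl
  have hcl : ∀ y ∈ Subring.closure {ω}, ∃ a b : ℤ, y = a + b * ω := by
    intro y hy
    induction hy using Subring.closure_induction with
    | mem x hx => exact ⟨0, 1, by simpa using hx⟩
    | zero => exact ⟨0, 0, by simp⟩
    | one => exact ⟨1, 0, by simp⟩
    | add x y _ _ hx hy =>
      obtain ⟨a, b, rfl⟩ := hx
      obtain ⟨c, d, rfl⟩ := hy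
      exact ⟨a + c, b + d, by push_cast; ring⟩
    | neg x _ hx =>
      obtain ⟨a, b, rfl⟩ := hx
      exact ⟨-a, -b, by push_cast; ring⟩
    | mul x y _ _ hx hy =>
      obtain ⟨a, b, rfl⟩ := hx
      obtain ⟨c, d, rfl⟩ := hy
      exact ⟨a * c - b * d, a * d + b * c - b * d, by
        push_cast; linear_combination (b * d : ℂ) * h2⟩
  obtain ⟨q, hq⟩ := aux_decomp g
  have hqm : Polynomial.aeval ω q ∈ Subring.closure {ω} := by
    rw [Polynomial.aeval_eq_sum_range]
    exact Subring.sum_mem _ fun i _ => Subring.zsmul_mem _ (Subring.pow_mem _ hmω i) _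
  have hg : Polynomial.aeval ω g = (1 - ω) ^ 2 * Polynomial.aeval ω q
      - (g.derivative.eval 1 : ℤ) * (1 - ω) + (g.eval 1 : ℤ) := by
    have := congrArg (Polynomial.aeval ω) hq
    simp only [map_add, map_mul, map_pow, map_sub, map_one, Polynomial.aeval_X,
      eq_intCast, map_intCast] at this
    rw [this]; ring
  generalize Polynomial.aeval ω q = Q at *
  rw [hg]
  generalize g.derivative.eval 1 = d at *
  generalize g.eval 1 = c at *
  have hint : ∀ n : ℤ, (n : ℂ) ∈ Subring.closure {ω} := fun n => intCast_mem _ n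
  obtain ⟨s, t, hst⟩ := hcl Q hqm
  refine ⟨⟨?_, ?_⟩, ⟨?_, ?_⟩⟩
  · rintro ⟨y, hy, h⟩
    obtain ⟨a, b, hab⟩ := hcl _ (Subring.add_mem _ (Subring.sub_mem _ hy
      (Subring.mul_mem _ (Subring.sub_mem _ (Subring.one_mem _) hmω) hqm)) (hint d))
    obtain ⟨h1, h1'⟩ := hind (c - a - b) (a - 2 * b) (by
      push_cast; linear_combination h + (1 - ω) * hab - b * h2)
    omega
  · rintro ⟨k, rfl⟩
    refine ⟨(1 - ω) * Q - d + k * (((2 : ℤ) : ℂ) + ω), ?_, ?_⟩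
    · exact Subring.add_mem _ (Subring.sub_mem _ (Subring.mul_mem _ (Subring.sub_mem _
        (Subring.one_mem _) hmω) hqm) (hint d)) (Subring.mul_mem _ (hint k)
        (Subring.add_mem _ (hint 2) hmω))
    · push_cast; linear_combination (k : ℂ) * h2
  · rintro ⟨y, hy, h⟩
    obtain ⟨a, b, hab⟩ := hcl _ (Subring.sub_mem _ hy hqm)
    obtain ⟨h1, h1'⟩ := hind (c - d - 3 * b) (d + 3 * a - 3 * b) (by
      push_cast
      linear_combination h + (1 - ω) ^ 2 * hab + (a + b * ω - 3 * b) * h2)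
    omega
  · rintro ⟨⟨k, rfl⟩, ⟨l, rfl⟩⟩
    refine ⟨Q + (l * (1 - ω) - k) * ω ^ 2, ?_, ?_⟩
    · exact Subring.add_mem _ hqm (Subring.mul_mem _ (Subring.sub_mem _ (Subring.mul_mem _
        (hint l) (Subring.sub_mem _ (Subring.one_mem _) hmω)) (hint k))
        (Subring.pow_mem _ hmω 2))
    · push_cast
      linear_combination (-(l * (1 - ω) - k : ℂ)) * (ω ^ 2 * h2 - 3 * h3)
end

section
/- Let m ≥ 3 and let u ∈ (ℤ[1/3, ω])^m be a vector with Σ_{j=1}^m |u_j|² = 1 and sde(u) = f > 0. Then there exists a finite sequence U_1, …, U_k of m×m matrices, each of which is either a 3-level matrix of type X, of type H, or of type S, or a 1-level matrix of type −1, such that χ^{f−1}·(U_1 U_2 ⋯ U_k u) ∈ ℤ[ω]^m; that is, every entry of U_1 ⋯ U_k u has denominator exponent at most f−1. -/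
/-- `ω = e^{2πi/3}`. -/
noncomputable def ω : ℂ := Complex.exp (2 * Real.pi * Complex.I / 3)

/-- The qutrit gate `X`: the cyclic permutation matrix sending `e₁ ↦ e₂ ↦ e₃ ↦ e₁`. -/
def X3 : Matrix (Fin 3) (Fin 3) ℂ := !![0, 0, 1; 1, 0, 0; 0, 1, 0]

/-- The qutrit gate `H = (1/(i√3))·[[1,1,1],[1,ω,ω²],[1,ω²,ω]]`. -/
noncomputable def H3 : Matrix (Fin 3) (Fin 3) ℂ :=
  (Complex.I * (Real.sqrt 3 : ℂ))⁻¹ • !![1, 1, 1; 1, ω, ω ^ 2; 1, ω ^ 2, ω]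

/-- The qutrit gate `S = diag(1, 1, ω)`. -/
noncomputable def S3 : Matrix (Fin 3) (Fin 3) ℂ := !![1, 0, 0; 0, 1, 0; 0, 0, ω]

/-- `M` is a 3-level matrix of type `U ∈ M₃(ℂ)`: for some pairwise distinct indices
`j₁, j₂, j₃`, the `(j_r, j_s)` entry of `M` is `U_{r,s}`, the remaining diagonal entries are
`1`, and all other entries are `0`. -/
def IsThreeLevel {m : ℕ} (U : Matrix (Fin 3) (Fin 3) ℂ) (M : Matrix (Fin m) (Fin m) ℂ) : Prop :=
  ∃ j : Fin 3 → Fin m, Function.Injective j ∧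
    (∀ r s, M (j r) (j s) = U r s) ∧
    ∀ i i', ((¬ ∃ r, j r = i) ∨ (¬ ∃ s, j s = i')) → M i i' = if i = i' then 1 else 0

open Complex in
lemma om_rel : ω ^ 2 + ω + 1 = 0 ∧ (starRingEnd ℂ) ω = ω ^ 2 ∧
    Complex.I * (Real.sqrt 3 : ℂ) = ω * (1 - ω) := by
  have h : ω = -1/2 + (Real.sqrt 3 : ℂ) / 2 * Complex.I := by
    have e : (2 * Real.pi * Complex.I / 3 : ℂ) = ((2 * Real.pi / 3 : ℝ) : ℂ) * Complex.I := by
      push_cast; ring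
    have hc : Real.cos (2 * Real.pi / 3) = -1/2 := by
      rw [show 2 * Real.pi / 3 = Real.pi - Real.pi / 3 by ring, Real.cos_pi_sub,
        Real.cos_pi_div_three]; norm_num
    have hs : Real.sin (2 * Real.pi / 3) = Real.sqrt 3 / 2 := by
      rw [show 2 * Real.pi / 3 = Real.pi - Real.pi / 3 by ring, Real.sin_pi_sub,
        Real.sin_pi_div_three]
    rw [ω, e, Complex.exp_mul_I, ← Complex.ofReal_cos, ← Complex.ofReal_sin, hc, hs]
    push_cast; ring
  have h3 : (Real.sqrt 3 : ℂ) ^ 2 = 3 := by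
    rw [← Complex.ofReal_pow, Real.sq_sqrt (by norm_num)]; norm_num
  have hI : Complex.I ^ 2 = -1 := Complex.I_sq
  refine ⟨?_, ?_, ?_⟩
  · rw [h]; linear_combination (Complex.I ^ 2 / 4) * h3 + (3/4) * hI
  · rw [h]
    simp only [map_add, map_mul, map_div₀, map_neg, map_one, Complex.conj_I, Complex.conj_ofReal,
      map_ofNat]
    linear_combination (-Complex.I ^ 2 / 4) * h3 - (3/4) * hI
  · rw [h]; linear_combination (Complex.I ^ 2 / 4) * h3 + (3/4) * hI

/-- The Eisenstein integers. -/
noncomputable abbrev RR : Subring ℂ := Subring.closure {ω}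

lemma om_mem : ω ∈ RR := Subring.subset_closure rfl

lemma chi_ne : (1 - ω) ≠ 0 := by
  intro h
  have h1 : ω = 1 := by linear_combination -h
  have := om_rel.1
  rw [h1] at this; norm_num at this

lemma om_ne : ω ≠ 0 := by
  intro h
  have := om_rel.1
  rw [h] at this; norm_num at this

lemma RR_form {z : ℂ} (hz : z ∈ RR) : ∃ a b : ℤ, z = a + b * ω := by
  have hr := om_rel.1
  induction hz using Subring.closure_induction with
  | mem x hx => exact ⟨0, 1, by rw [Set.mem_singleton_iff.1 hx]; simp⟩
  | zero => exact ⟨0, 0, by simp⟩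
  | one => exact ⟨1, 0, by simp⟩
  | add x y _ _ hx hy =>
    obtain ⟨a, b, rfl⟩ := hx
    obtain ⟨c, d, rfl⟩ := hy
    exact ⟨a + c, b + d, by push_cast; ring⟩
  | neg x _ hx =>
    obtain ⟨a, b, rfl⟩ := hx
    exact ⟨-a, -b, by push_cast; ring⟩
  | mul x y _ _ hx hy =>
    obtain ⟨a, b, rfl⟩ := hx
    obtain ⟨c, d, rfl⟩ := hy
    exact ⟨a * c - b * d, a * d + b * c - b * d, by
      push_cast; linear_combination (b * d : ℂ) * hr⟩

lemma form_mem (a b : ℤ) : (a + b * ω : ℂ) ∈ RR :=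
  add_mem (intCast_mem _ a) (mul_mem (intCast_mem _ b) om_mem)

/-- Divisibility by `χ`. -/
def DD (z : ℂ) : Prop := ∃ y ∈ RR, z = (1 - ω) * y

lemma DD_mem {z : ℂ} (h : DD z) : z ∈ RR := by
  obtain ⟨y, hy, rfl⟩ := h
  exact mul_mem (sub_mem (one_mem _) om_mem) hy

lemma form_DD (a b : ℤ) (h : (3 : ℤ) ∣ a + b) : DD (a + b * ω) := by
  obtain ⟨c, hc⟩ := h
  refine ⟨(2 * c - b : ℤ) + c * ω, form_mem _ _, ?_⟩
  have hr := om_rel.1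
  have hc' : (a : ℂ) + b = 3 * c := by exact_mod_cast hc
  push_cast
  linear_combination hc' + (c : ℂ) * hr

lemma form_norm (a b : ℤ) : (a + b * ω : ℂ) * (starRingEnd ℂ) (a + b * ω) =
    ((a ^ 2 - a * b + b ^ 2 : ℤ) : ℂ) := by
  obtain ⟨hr, hc, -⟩ := om_rel
  simp only [map_add, map_mul, hc, map_intCast]
  push_cast
  linear_combination (a * b + b ^ 2 * (ω - 1) : ℂ) * hr

lemma norm_mod {z : ℂ} (hz : z ∈ RR) : ∃ n : ℤ, z * (starRingEnd ℂ) z = n ∧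
    (DD z → (3 : ℤ) ∣ n) ∧ (¬ DD z → (3 : ℤ) ∣ n - 1) := by
  obtain ⟨a, b, rfl⟩ := RR_form hz
  refine ⟨_, form_norm a b, ?_, ?_⟩
  · rintro ⟨y, hy, h⟩
    obtain ⟨c, d, rfl⟩ := RR_form hy
    refine ⟨c ^ 2 - c * d + d ^ 2, ?_⟩
    have h1 := form_norm a b
    rw [h, map_mul, mul_mul_mul_comm, form_norm c d] at h1
    have h2 : (1 - ω) * (starRingEnd ℂ) (1 - ω) = 3 := by
      obtain ⟨hr, hc, -⟩ := om_rel
      rw [map_sub, map_one, hc]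
      linear_combination (ω - 2) * hr
    rw [h2] at h1
    exact_mod_cast h1.symm
  · intro h
    have h3 : ¬ (3 : ℤ) ∣ a + b := fun h' => h (form_DD a b h')
    have h4 : (3 : ℤ) ∣ (a + b) ^ 2 - 1 := by
      have : (a + b) % 3 = 1 ∨ (a + b) % 3 = 2 := by omega
      rcases this with h | h
      · have : (3 : ℤ) ∣ (a + b - 1) := by omega
        exact (this.mul_right (a + b + 1)).trans (by ring_nf; rfl)
      · have : (3 : ℤ) ∣ (a + b + 1) := by omega
        exact (this.mul_right (a + b - 1)).trans (by ring_nf; rfl)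
    have : a ^ 2 - a * b + b ^ 2 - 1 = ((a + b) ^ 2 - 1) - 3 * (a * b) := by ring
    rw [this]
    exact dvd_sub h4 (dvd_mul_right _ _)

/-- Congruent to 1 mod 3. -/
def One3 (z : ℂ) : Prop := ∃ y ∈ RR, z = 1 + 3 * y

lemma form_One3 (a b : ℤ) (ha : a % 3 = 1) (hb : b % 3 = 0) : One3 (a + b * ω) := by
  refine ⟨((a / 3 : ℤ) : ℂ) + (b / 3 : ℤ) * ω, form_mem _ _, ?_⟩
  have h1 : (a : ℂ) = 1 + 3 * (a / 3 : ℤ) := by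
    have : a = 1 + 3 * (a / 3) := by omega
    exact_mod_cast this
  have h2 : (b : ℂ) = 3 * (b / 3 : ℤ) := by
    have : b = 3 * (b / 3) := by omega
    exact_mod_cast this
  linear_combination h1 + ω * h2

lemma normalize_aux (a b : ℤ) (h : (a + b) % 3 = 1) :
    ∃ k : ℕ, One3 (ω ^ k * (a + b * ω)) := by
  have hr := om_rel.1
  have : b % 3 = 0 ∨ b % 3 = 1 ∨ b % 3 = 2 := by omega
  rcases this with hb | hb | hb
  · exact ⟨0, by simpa using form_One3 a b (by omega) hb⟩
  · refine ⟨2, ?_⟩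
    have := form_One3 (b - a) (-a) (by omega) (by omega)
    convert this using 1
    push_cast
    linear_combination (a + b * (ω - 1) : ℂ) * hr
  · refine ⟨1, ?_⟩
    have := form_One3 (-b) (a - b) (by omega) (by omega)
    convert this using 1
    push_cast
    linear_combination (b : ℂ) * hr

lemma norm_unit {z : ℂ} (hz : z ∈ RR) (h : ¬ DD z) :
    ∃ k l : ℕ, One3 (ω ^ k * ((-1) ^ l * z)) := by
  obtain ⟨a, b, rfl⟩ := RR_form hz
  have h3 : ¬ (3 : ℤ) ∣ a + b := fun h' => h (form_DD a b h')
  have : (a + b) % 3 = 1 ∨ (a + b) % 3 = 2 := by omega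
  rcases this with h | h
  · obtain ⟨k, hk⟩ := normalize_aux a b h
    exact ⟨k, 0, by simpa using hk⟩
  · obtain ⟨k, hk⟩ := normalize_aux (-a) (-b) (by omega)
    refine ⟨k, 1, ?_⟩
    convert hk using 2
    push_cast; ring

/-- A permitted gate. -/
def Gate {m : ℕ} (M : Matrix (Fin m) (Fin m) ℂ) : Prop :=
  IsThreeLevel X3 M ∨ IsThreeLevel H3 M ∨ IsThreeLevel S3 M ∨ IsOneLevel (-1) M

/-- Reachability by gates. -/
def Reach {m : ℕ} (v w : Fin m → ℂ) : Prop :=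
  ∃ Us : List (Matrix (Fin m) (Fin m) ℂ), (∀ M ∈ Us, Gate M) ∧ Us.prod.mulVec v = w

lemma Reach.refl {m : ℕ} (v : Fin m → ℂ) : Reach v v := ⟨[], by simp, by simp⟩

lemma Reach.trans {m : ℕ} {v w x : Fin m → ℂ} (h : Reach v w) (h' : Reach w x) : Reach v x := by
  obtain ⟨A, hA, rfl⟩ := h
  obtain ⟨B, hB, rfl⟩ := h'
  refine ⟨B ++ A, ?_, ?_⟩
  · intro M hM
    rcases List.mem_append.1 hM with h | h
    · exact hB _ h
    · exact hA _ h
  · rw [List.prod_append, Matrix.mulVec_mulVec]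

lemma Reach.gate {m : ℕ} {M : Matrix (Fin m) (Fin m) ℂ} (h : Gate M) (v : Fin m → ℂ) :
    Reach v (M.mulVec v) := ⟨[M], by simpa using h, by simp⟩

open Classical in
lemma exists_three {m : ℕ} (U : Matrix (Fin 3) (Fin 3) ℂ) (j : Fin 3 → Fin m)
    (hj : Function.Injective j) : ∃ M, IsThreeLevel U M ∧ ∀ v : Fin m → ℂ,
      (∀ r, M.mulVec v (j r) = ∑ s, U r s * v (j s)) ∧
      ∀ i, (∀ r, j r ≠ i) → M.mulVec v i = v i := by
  let M : Matrix (Fin m) (Fin m) ℂ := fun i i' =>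
    if h : (∃ r, j r = i) ∧ (∃ s, j s = i') then U h.1.choose h.2.choose
    else if i = i' then 1 else 0
  have hM1 : ∀ r s, M (j r) (j s) = U r s := by
    intro r s
    have h : (∃ r', j r' = j r) ∧ (∃ s', j s' = j s) := ⟨⟨r, rfl⟩, ⟨s, rfl⟩⟩
    have e : M (j r) (j s) = U h.1.choose h.2.choose := dif_pos h
    rw [e, hj h.1.choose_spec, hj h.2.choose_spec]
  have hM2 : ∀ i i', ((¬ ∃ r, j r = i) ∨ (¬ ∃ s, j s = i')) →
      M i i' = if i = i' then 1 else 0 := by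
    intro i i' h
    exact dif_neg (by tauto)
  refine ⟨M, ⟨j, hj, hM1, hM2⟩, fun v => ⟨fun r => ?_, fun i hi => ?_⟩⟩
  · rw [Matrix.mulVec, dotProduct]
    rw [← Finset.sum_subset (Finset.subset_univ (Finset.univ.image j)),
      Finset.sum_image (fun a _ b _ h => hj h)]
    · simp only [hM1]
    · intro x _ hx
      have hx' : ¬ ∃ s, j s = x := by simpa using hx
      rw [hM2 _ _ (Or.inr hx'), if_neg, zero_mul]
      exact fun h => hx' ⟨r, h⟩
  · rw [Matrix.mulVec, dotProduct]
    have : ∀ i', M i i' = if i = i' then 1 else 0 := fun i' =>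
      hM2 i i' (Or.inl (by simpa using hi))
    simp [this]

lemma reach_neg {m : ℕ} (v : Fin m → ℂ) (i : Fin m) :
    Reach v (Function.update v i (-1 * v i)) := by
  convert Reach.gate (Or.inr (Or.inr (Or.inr ⟨i, rfl⟩))) v using 1
  ext k
  simp only [Matrix.mulVec, dotProduct, Matrix.of_apply, ite_mul, zero_mul, Finset.sum_ite_eq,
    Finset.mem_univ, if_true, one_mul]
  by_cases h : k = i
  · subst h; simp
  · simp [h]

lemma reach_om {m : ℕ} (hm : 3 ≤ m) (v : Fin m → ℂ) (i : Fin m) :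
    Reach v (Function.update v i (ω * v i)) := by
  obtain ⟨j, hj, hji⟩ : ∃ j : Fin 3 → Fin m, Function.Injective j ∧ j 2 = i := by
    let c : Fin 3 → Fin m := Fin.castLE hm
    refine ⟨Equiv.swap (c 2) i ∘ c, (Equiv.injective _).comp (Fin.castLE_injective hm), ?_⟩
    simp
  obtain ⟨M, hM, h⟩ := exists_three S3 j hj
  convert Reach.gate (Or.inr (Or.inr (Or.inl hM))) v using 1
  ext k
  by_cases hk : ∃ r, j r = k
  · obtain ⟨r, rfl⟩ := hk
    rw [(h v).1]
    subst hji
    fin_cases r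
    · have : j 0 ≠ j 2 := hj.ne (by decide)
      simp [Fin.sum_univ_three, S3, this]
    · have : j 1 ≠ j 2 := hj.ne (by decide)
      simp [Fin.sum_univ_three, S3, this]
    · simp [Fin.sum_univ_three, S3]
  · rw [(h v).2 k (by simpa using hk), Function.update_of_ne]
    rintro rfl
    exact hk ⟨2, hji⟩

lemma reach_pow {m : ℕ} (c : ℂ) (i : Fin m)
    (H : ∀ v : Fin m → ℂ, Reach v (Function.update v i (c * v i))) (k : ℕ) (v : Fin m → ℂ) :
    Reach v (Function.update v i (c ^ k * v i)) := by
  induction k with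
  | zero => simpa using Reach.refl v
  | succ k ih =>
    have := ih.trans (H _)
    simpa [pow_succ', mul_assoc] using this

lemma reach_one3 {m : ℕ} (hm : 3 ≤ m) (v : Fin m → ℂ) (i : Fin m) (hv : v i ∈ RR)
    (hd : ¬ DD (v i)) : ∃ z, One3 z ∧ Reach v (Function.update v i z) := by
  obtain ⟨k, l, h⟩ := norm_unit hv hd
  refine ⟨_, h, ?_⟩
  have h1 := reach_pow (-1) i (fun v => reach_neg v i) l v
  have h2 := h1.trans (reach_pow ω i (fun v => reach_om hm v i) k _)
  simpa using h2

lemma H_div {x y z : ℂ} (hx : One3 x) (hy : One3 y) (hz : One3 z) :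
    DD ((Complex.I * (Real.sqrt 3 : ℂ))⁻¹ * (x + y + z)) ∧
    DD ((Complex.I * (Real.sqrt 3 : ℂ))⁻¹ * (x + ω * y + ω ^ 2 * z)) ∧
    DD ((Complex.I * (Real.sqrt 3 : ℂ))⁻¹ * (x + ω ^ 2 * y + ω * z)) := by
  obtain ⟨hr, -, hi⟩ := om_rel
  obtain ⟨x, hx, rfl⟩ := hx
  obtain ⟨y, hy, rfl⟩ := hy
  obtain ⟨z, hz, rfl⟩ := hz
  have key : ∀ w ∈ RR, DD ((Complex.I * (Real.sqrt 3 : ℂ))⁻¹ * (3 * w)) := by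
    intro w hw
    refine ⟨-ω * w, mul_mem (neg_mem om_mem) hw, ?_⟩
    have : Complex.I * (Real.sqrt 3 : ℂ) ≠ 0 := by
      rw [hi]; exact mul_ne_zero om_ne chi_ne
    rw [inv_mul_eq_iff_eq_mul₀ this, hi]
    linear_combination (ω ^ 2 - 3 * ω + 3) * w * hr
  have ho := om_mem
  have ho2 : ω ^ 2 ∈ RR := pow_mem om_mem 2
  refine ⟨?_, ?_, ?_⟩
  · convert key (1 + (x + y + z)) (add_mem (one_mem _) (add_mem (add_mem hx hy) hz)) using 2
    ring
  · convert key (x + ω * y + ω ^ 2 * z)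
      (add_mem (add_mem hx (mul_mem ho hy)) (mul_mem ho2 hz)) using 2
    linear_combination hr
  · convert key (x + ω ^ 2 * y + ω * z)
      (add_mem (add_mem hx (mul_mem ho2 hy)) (mul_mem ho hz)) using 2
    linear_combination hr

lemma reach_triple {m : ℕ} (hm : 3 ≤ m) (v : Fin m → ℂ) (a b c : Fin m) (hab : a ≠ b)
    (hac : a ≠ c) (hbc : b ≠ c) (hv : ∀ i, v i ∈ RR) (ha : ¬ DD (v a)) (hb : ¬ DD (v b))
    (hc : ¬ DD (v c)) : ∃ w, Reach v w ∧ DD (w a) ∧ DD (w b) ∧ DD (w c) ∧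
      ∀ i, i ≠ a → i ≠ b → i ≠ c → w i = v i := by
  obtain ⟨x, hx, h1⟩ := reach_one3 hm v a (hv a) ha
  set v1 := Function.update v a x with hv1
  have e1 : v1 b = v b := by simp [hv1, hab.symm]
  obtain ⟨y, hy, h2⟩ := reach_one3 hm v1 b (e1 ▸ hv b) (e1 ▸ hb)
  set v2 := Function.update v1 b y with hv2
  have e2 : v2 c = v c := by simp [hv2, hv1, hbc.symm, hac.symm]
  obtain ⟨z, hz, h3⟩ := reach_one3 hm v2 c (e2 ▸ hv c) (e2 ▸ hc)
  set v3 := Function.update v2 c z with hv3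
  have ea : v3 a = x := by simp [hv3, hv2, hv1, hab, hac]
  have eb : v3 b = y := by simp [hv3, hv2, hbc]
  have ec : v3 c = z := by simp [hv3]
  have hj : Function.Injective ![a, b, c] := by
    intro r s h
    fin_cases r <;> fin_cases s <;> simp_all [eq_comm]
  obtain ⟨M, hM, h⟩ := exists_three H3 ![a, b, c] hj
  obtain ⟨g1, g2, g3⟩ := H_div hx hy hz
  refine ⟨_, (h1.trans (h2.trans h3)).trans (Reach.gate (Or.inr (Or.inl hM)) v3), ?_, ?_, ?_, ?_⟩
  · have := (h v3).1 0
    simp only [Matrix.cons_val_zero] at this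
    rw [this]
    convert g1 using 1
    simp [Fin.sum_univ_three, H3, ea, eb, ec]; ring
  · have := (h v3).1 1
    rw [show (![a, b, c] : Fin 3 → Fin m) 1 = b from rfl] at this
    rw [this]
    convert g2 using 1
    simp [Fin.sum_univ_three, H3, ea, eb, ec]; ring
  · have := (h v3).1 2
    rw [show (![a, b, c] : Fin 3 → Fin m) 2 = c from rfl] at this
    rw [this]
    convert g3 using 1
    simp [Fin.sum_univ_three, H3, ea, eb, ec]; ring
  · intro i hia hib hic
    rw [(h v3).2 i]
    · simp [hv3, hv2, hv1, hia, hib, hic]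
    · intro r
      fin_cases r
      · exact hia.symm
      · exact hib.symm
      · exact hic.symm

open Classical in
lemma reach_all {m : ℕ} (hm : 3 ≤ m) (n : ℕ) : ∀ v : Fin m → ℂ, (∀ i, v i ∈ RR) →
    (Finset.univ.filter fun i => ¬ DD (v i)).card = 3 * n →
    ∃ w, Reach v w ∧ ∀ i, DD (w i) := by
  induction n with
  | zero =>
    intro v hv h
    refine ⟨v, Reach.refl v, fun i => ?_⟩
    by_contra hi
    have : Finset.univ.filter (fun i => ¬ DD (v i)) = ∅ := by simpa using h
    have h' : i ∈ Finset.univ.filter (fun i => ¬ DD (v i)) := by simp [hi]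
    rw [this] at h'
    simp at h'
  | succ n ih =>
    intro v hv h
    obtain ⟨t, ht, htc⟩ := Finset.exists_subset_card_eq
      (s := Finset.univ.filter fun i => ¬ DD (v i)) (n := 3) (by omega)
    obtain ⟨a, b, c, hab, hac, hbc, rfl⟩ := Finset.card_eq_three.1 htc
    have hS : ∀ i ∈ ({a, b, c} : Finset (Fin m)), ¬ DD (v i) := fun i hi => by
      simpa using ht hi
    obtain ⟨w, hw, wa, wb, wc, wo⟩ := reach_triple hm v a b c hab hac hbc hv
      (hS a (by simp)) (hS b (by simp)) (hS c (by simp))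
    have hwf : Finset.univ.filter (fun i => ¬ DD (w i)) =
        (Finset.univ.filter fun i => ¬ DD (v i)) \ {a, b, c} := by
      ext i
      simp only [Finset.mem_filter, Finset.mem_univ, true_and, Finset.mem_sdiff,
        Finset.mem_insert, Finset.mem_singleton]
      by_cases h1 : i = a
      · subst h1; tauto
      by_cases h2 : i = b
      · subst h2; tauto
      by_cases h3 : i = c
      · subst h3; tauto
      rw [wo i h1 h2 h3]; tauto
    have hwm : ∀ i, w i ∈ RR := by
      intro i
      by_cases h1 : i = a
      · subst h1; exact DD_mem wa
      by_cases h2 : i = b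
      · subst h2; exact DD_mem wb
      by_cases h3 : i = c
      · subst h3; exact DD_mem wc
      rw [wo i h1 h2 h3]; exact hv i
    have hwc : (Finset.univ.filter fun i => ¬ DD (w i)).card = 3 * n := by
      rw [hwf, Finset.card_sdiff_of_subset ht, htc, h, Nat.mul_succ, Nat.add_sub_cancel]
    obtain ⟨x, hx, hx'⟩ := ih w hwm hwc
    exact ⟨x, hw.trans hx, hx'⟩

open Classical in
lemma card_div {m : ℕ} (v : Fin m → ℂ) (hv : ∀ i, v i ∈ RR) (N : ℤ) (hN : (3 : ℤ) ∣ N)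
    (h : ∑ i, v i * (starRingEnd ℂ) (v i) = N) :
    3 ∣ (Finset.univ.filter fun i => ¬ DD (v i)).card := by
  choose n hn h1 h2 using fun i => norm_mod (hv i)
  simp only [hn] at h
  have h' : ∑ i, n i = N := by exact_mod_cast h
  have hc : ((Finset.univ.filter fun i => ¬ DD (v i)).card : ℤ) =
      ∑ i, if ¬ DD (v i) then (1 : ℤ) else 0 := by
    rw [Finset.card_filter]; push_cast; rfl
  have hd : (3 : ℤ) ∣ ∑ i, (n i - if ¬ DD (v i) then (1 : ℤ) else 0) := by
    refine Finset.dvd_sum fun i _ => ?_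
    by_cases hi : DD (v i)
    · simpa [hi] using h1 i hi
    · simpa [hi] using h2 i hi
  rw [Finset.sum_sub_distrib, h', ← hc] at hd
  omega

/-- For `m ≥ 3` and a unit vector `u ∈ (ℤ[1/3, ω])^m` with `sde(u) = f > 0`
(with respect to `χ = 1 − ω`), there is a finite sequence of `m×m` matrices, each a 3-level
matrix of type `X`, `H` or `S`, or a 1-level matrix of type `−1`, such that every entry of the
image of `u` under their product has denominator exponent at most `f − 1`. -/
theorem sde_reduction_step
    (m : ℕ) (hm : 3 ≤ m)
    (u : Fin m → ℂ) (hu : ∀ j, u j ∈ Subring.closure {(3 : ℂ)⁻¹, ω})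
    (hnorm : ∑ j, u j * (starRingEnd ℂ) (u j) = 1)
    (f : ℕ) (hf : 0 < f)
    (hden : ∀ j, (1 - ω) ^ f * u j ∈ Subring.closure {ω})
    (hmin : ∀ f' < f, ¬ ∀ j, (1 - ω) ^ f' * u j ∈ Subring.closure {ω}) :
    ∃ Us : List (Matrix (Fin m) (Fin m) ℂ),
      (∀ M ∈ Us,
        IsThreeLevel X3 M ∨ IsThreeLevel H3 M ∨ IsThreeLevel S3 M ∨ IsOneLevel (-1) M) ∧
      ∀ j, (1 - ω) ^ (f - 1) * (Us.prod.mulVec u) j ∈ Subring.closure {ω} := by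
  set v : Fin m → ℂ := (1 - ω) ^ f • u with hv
  have hvm : ∀ i, v i ∈ RR := fun i => by simpa [hv] using hden i
  have h2 : (1 - ω) * (starRingEnd ℂ) (1 - ω) = 3 := by
    obtain ⟨hr, hc, -⟩ := om_rel
    rw [map_sub, map_one, hc]
    linear_combination (ω - 2) * hr
  have hs : ∑ i, v i * (starRingEnd ℂ) (v i) = ((3 ^ f : ℤ) : ℂ) := by
    have : ∀ i, v i * (starRingEnd ℂ) (v i) = 3 ^ f * (u i * (starRingEnd ℂ) (u i)) := by
      intro i
      simp only [hv, Pi.smul_apply, smul_eq_mul, map_mul, map_pow]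
      rw [mul_mul_mul_comm, ← mul_pow, h2]
    simp only [this, ← Finset.mul_sum, hnorm]
    push_cast; ring
  obtain ⟨n, hn⟩ := card_div v hvm _ (dvd_pow_self 3 hf.ne') hs
  obtain ⟨w, ⟨Us, hU, hw⟩, hd⟩ := reach_all hm n v hvm hn
  refine ⟨Us, hU, fun j => ?_⟩
  obtain ⟨y, hy, e⟩ := hd j
  have : (1 - ω) ^ (f - 1) * (Us.prod.mulVec u) j = y := by
    apply mul_left_cancel₀ chi_ne
    rw [← e, ← hw, hv, Matrix.mulVec_smul, Pi.smul_apply, smul_eq_mul, ← mul_assoc, ← pow_succ',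
      Nat.sub_add_cancel hf]
  rw [this]; exact hy
end

section
/- Let m ≥ 1 and let U be an m×m unitary matrix all of whose entries lie in ℤ[1/3, ω]. Then there exists a finite sequence U_1, …, U_k of m×m matrices, each of which is either a 3-level matrix of type X, of type S, or of type H, or a 2-level matrix of type [[0,1],[1,0]], or a 1-level matrix of type ω or of type −1, such that U = U_1 U_2 ⋯ U_k. -/
namespace QD
open Matrix

noncomputable def θ : ℂ := Complex.I * (Real.sqrt 3 : ℂ)

lemma sqrt3_sq : ((Real.sqrt 3 : ℝ) : ℂ) ^ 2 = 3 := by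
  rw [← Complex.ofReal_pow, Real.sq_sqrt (by norm_num)]; norm_num

lemma theta_sq : θ ^ 2 = -3 := by
  rw [θ, mul_pow, sqrt3_sq, Complex.I_sq]; ring

lemma theta_ne : θ ≠ 0 := by
  intro h
  have := theta_sq
  rw [h] at this
  norm_num at this

lemma omega_eq : ω = (-1 + θ) / 2 := by
  have h : (2 * (Real.pi : ℂ) * Complex.I / 3) = ((Real.pi - Real.pi / 3 : ℝ) : ℂ) * Complex.I := by
    push_cast; ring
  rw [ω, h, Complex.exp_mul_I, ← Complex.ofReal_cos, ← Complex.ofReal_sin, Real.cos_pi_sub,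
    Real.sin_pi_sub, Real.cos_pi_div_three, Real.sin_pi_div_three, θ]
  push_cast; ring

lemma theta_eq : θ = 1 + 2 * ω := by rw [omega_eq]; ring

lemma omega_rel : ω ^ 2 = -1 - ω := by
  rw [omega_eq]; linear_combination (1/4) * theta_sq

lemma star_theta : star θ = -θ := by
  simp [θ]

lemma star_omega : star ω = -1 - ω := by
  have : star ω = (-1 + star θ) / 2 := by rw [omega_eq]; simp
  rw [this, star_theta, omega_eq]; ring

/-- Eisenstein integers. -/
noncomputable def O : Subring ℂ where
  carrier := {z | ∃ a b : ℤ, z = a + b * ω}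
  mul_mem' := by
    rintro _ _ ⟨a, b, rfl⟩ ⟨c, d, rfl⟩
    refine ⟨a * c - b * d, a * d + b * c - b * d, ?_⟩
    push_cast
    linear_combination (b * d : ℂ) * omega_rel
  one_mem' := ⟨1, 0, by simp⟩
  add_mem' := by
    rintro _ _ ⟨a, b, rfl⟩ ⟨c, d, rfl⟩
    exact ⟨a + c, b + d, by push_cast; ring⟩
  zero_mem' := ⟨0, 0, by simp⟩
  neg_mem' := by
    rintro _ ⟨a, b, rfl⟩
    exact ⟨-a, -b, by push_cast; ring⟩

lemma omega_O : ω ∈ O := ⟨0, 1, by simp⟩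
lemma theta_O : θ ∈ O := ⟨1, 2, by rw [theta_eq]; push_cast; ring⟩
lemma star_O {z : ℂ} (h : z ∈ O) : star z ∈ O := by
  obtain ⟨a, b, rfl⟩ := h
  refine ⟨a - b, -b, ?_⟩
  have : star ((a : ℂ) + b * ω) = a + b * star ω := by simp
  rw [this, star_omega]; push_cast; ring

lemma pow_up {z : ℂ} {k : ℕ} (h : θ ^ k * z ∈ O) {l : ℕ} (hl : k ≤ l) : θ ^ l * z ∈ O := by
  obtain ⟨d, rfl⟩ := Nat.exists_eq_add_of_le hl
  have : θ ^ (k + d) * z = θ ^ d * (θ ^ k * z) := by ring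
  rw [this]; exact O.mul_mem (O.pow_mem theta_O _) h

noncomputable def R : Subring ℂ where
  carrier := {z | ∃ k : ℕ, θ ^ k * z ∈ O}
  mul_mem' := by
    rintro x y ⟨k, hk⟩ ⟨l, hl⟩
    refine ⟨k + l, ?_⟩
    have : θ ^ (k + l) * (x * y) = (θ ^ k * x) * (θ ^ l * y) := by ring
    rw [this]; exact O.mul_mem hk hl
  one_mem' := ⟨0, by simp⟩
  add_mem' := by
    rintro x y ⟨k, hk⟩ ⟨l, hl⟩
    refine ⟨k + l, ?_⟩
    rw [mul_add]
    exact O.add_mem (pow_up hk (by omega)) (pow_up hl (by omega))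
  zero_mem' := ⟨0, by simp⟩
  neg_mem' := by
    rintro x ⟨k, hk⟩
    exact ⟨k, by rw [mul_neg]; exact O.neg_mem hk⟩

lemma O_R {z : ℂ} (h : z ∈ O) : z ∈ R := ⟨0, by simpa using h⟩
lemma star_R {z : ℂ} (h : z ∈ R) : star z ∈ R := by
  obtain ⟨k, hk⟩ := h
  refine ⟨k, ?_⟩
  have h1 := star_O hk
  rw [star_mul', star_pow, star_theta] at h1
  have : θ ^ k * star z = (-1) ^ k * ((-θ) ^ k * star z) := by
    rw [← mul_assoc, ← mul_pow]; ring
  rw [this]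
  exact O.mul_mem (O.pow_mem (O.neg_mem O.one_mem) _) h1

lemma closure_R : Subring.closure {(3 : ℂ)⁻¹, ω} ≤ R := by
  rw [Subring.closure_le]
  rintro z (rfl | rfl)
  · refine ⟨2, ?_⟩
    rw [theta_sq]
    have : (-3 : ℂ) * 3⁻¹ = -1 := by norm_num
    rw [this]; exact O.neg_mem O.one_mem
  · exact O_R omega_O

lemma theta_inv_R : θ⁻¹ ∈ R := ⟨1, by rw [pow_one, mul_inv_cancel₀ theta_ne]; exact O.one_mem⟩

/-- divisible by θ -/
def Dv (z : ℂ) : Prop := ∃ w ∈ O, z = θ * w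

lemma omega_im : ω.im ≠ 0 := by
  rw [omega_eq]
  simp [θ]

lemma O_ext {a b c d : ℤ} (h : (a : ℂ) + b * ω = c + d * ω) : a = c ∧ b = d := by
  have h2 : b = d := by
    have := congrArg Complex.im h
    simp at this
    have h3 := omega_im
    rcases this with h | h
    · exact_mod_cast h
    · exact absurd h h3
  subst h2
  exact ⟨by exact_mod_cast add_right_cancel h, rfl⟩

lemma Dv_iff (a b : ℤ) : Dv ((a : ℂ) + b * ω) ↔ (3 : ℤ) ∣ a + b := by
  constructor
  · rintro ⟨_, ⟨c, d, rfl⟩, h⟩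
    have : (a : ℂ) + b * ω = ((c - 2 * d : ℤ) : ℂ) + ((2 * c - d : ℤ) : ℂ) * ω := by
      rw [h, theta_eq]; push_cast
      linear_combination (2 * d : ℂ) * omega_rel
    obtain ⟨h1, h2⟩ := O_ext this
    exact ⟨c - d, by omega⟩
  · rintro ⟨n, hn⟩
    refine ⟨((2 * n - a : ℤ) : ℂ) + ((n - a : ℤ) : ℂ) * ω, ⟨_, _, rfl⟩, ?_⟩
    have hb : (b : ℂ) = 3 * n - a := by
      have : b = 3 * n - a := by omega
      rw [this]; push_cast; ring
    rw [hb, theta_eq]; push_cast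
    linear_combination (-2 * (n - a : ℂ)) * omega_rel

lemma norm_eq (a b : ℤ) : star ((a : ℂ) + b * ω) * ((a : ℂ) + b * ω)
    = ((a ^ 2 - a * b + b ^ 2 : ℤ) : ℂ) := by
  have : star ((a : ℂ) + b * ω) = a + b * star ω := by simp
  rw [this, star_omega]; push_cast
  linear_combination (-(b : ℂ) ^ 2) * omega_rel

/-- Units: generated by ω and -1. -/
noncomputable def Un : Submonoid ℂ := Submonoid.closure {ω, -1}
lemma Un_omega : ω ∈ Un := Submonoid.subset_closure (by simp)
lemma Un_neg : (-1 : ℂ) ∈ Un := Submonoid.subset_closure (by simp)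
lemma Un_sq : -1 - ω ∈ Un := by rw [← omega_rel]; exact Un.pow_mem Un_omega 2
lemma Un_nomega : -ω ∈ Un := by
  have := Un.mul_mem Un_neg Un_omega
  simpa using this
lemma Un_nsq : 1 + ω ∈ Un := by
  have := Un.mul_mem Un_neg Un_sq
  convert this using 1; ring

lemma norm_facts {z : ℂ} (hz : z ∈ O) : ∃ n : ℤ, star z * z = n ∧ 0 ≤ n ∧ (n = 0 → z = 0) ∧
    (n = 1 → z ∈ Un) ∧ (Dv z → (n : ZMod 3) = 0) ∧ (¬ Dv z → (n : ZMod 3) = 1) := by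
  obtain ⟨a, b, rfl⟩ := hz
  refine ⟨_, norm_eq a b, by nlinarith [sq_nonneg (a - b), sq_nonneg a, sq_nonneg b], ?_, ?_, ?_, ?_⟩
  · intro h
    have ha : a = 0 := by
      have : a ^ 2 ≤ 0 := by nlinarith [sq_nonneg (a - 2 * b)]
      nlinarith [sq_nonneg a, pow_eq_zero_iff (two_ne_zero) |>.1 (le_antisymm this (sq_nonneg a))]
    subst ha
    have hb : b = 0 := by
      have : b ^ 2 = 0 := by linarith
      exact pow_eq_zero_iff (two_ne_zero) |>.1 this
    subst hb; simp
  · intro h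
    have h1 : -1 ≤ a := by nlinarith [sq_nonneg (a - 2 * b)]
    have h2 : a ≤ 1 := by nlinarith [sq_nonneg (a - 2 * b)]
    have h3 : -1 ≤ b := by nlinarith [sq_nonneg (b - 2 * a)]
    have h4 : b ≤ 1 := by nlinarith [sq_nonneg (b - 2 * a)]
    interval_cases a <;> interval_cases b <;> simp at h <;> push_cast
    · convert Un_sq using 1; ring
    · convert Un_neg using 1; ring
    · convert Un_nomega using 1; ring
    · convert Un_omega using 1; ring
    · convert Un.one_mem using 1; ring
    · convert Un_nsq using 1; ring
  · rw [Dv_iff]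
    intro h
    have h1 := (ZMod.intCast_zmod_eq_zero_iff_dvd (a + b) 3).2 (by exact_mod_cast h)
    push_cast at h1 ⊢
    generalize (a : ZMod 3) = x at *
    generalize (b : ZMod 3) = y at *
    revert x y; decide
  · rw [Dv_iff]
    intro h
    have h1 := mt (ZMod.intCast_zmod_eq_zero_iff_dvd (a + b) 3).1 (by exact_mod_cast h)
    push_cast at h1 ⊢
    generalize (a : ZMod 3) = x at *
    generalize (b : ZMod 3) = y at *
    revert x y; decide

lemma unit_red {z : ℂ} (hz : z ∈ O) (h : ¬ Dv z) : ∃ u ∈ Un, ∃ t ∈ O, z = u * (1 + 3 * t) := by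
  obtain ⟨a, b, rfl⟩ := hz
  rw [Dv_iff] at h
  have ha : a % 3 = 0 ∨ a % 3 = 1 ∨ a % 3 = 2 := by omega
  have hb : b % 3 = 0 ∨ b % 3 = 1 ∨ b % 3 = 2 := by omega
  have ea : (a : ℂ) = 3 * ((a / 3 : ℤ) : ℂ) + ((a % 3 : ℤ) : ℂ) := by
    exact_mod_cast (Int.mul_ediv_add_emod a 3).symm
  have eb : (b : ℂ) = 3 * ((b / 3 : ℤ) : ℂ) + ((b % 3 : ℤ) : ℂ) := by
    exact_mod_cast (Int.mul_ediv_add_emod b 3).symm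
  set p : ℤ := a / 3
  set q : ℤ := b / 3
  rcases ha with ha | ha | ha <;> rcases hb with hb | hb | hb <;> rw [ha] at ea <;> rw [hb] at eb <;>
    rw [ea, eb]
  · omega
  · refine ⟨_, Un_omega, ((q - p : ℤ) : ℂ) + ((-p : ℤ) : ℂ) * ω, ⟨_, _, rfl⟩, ?_⟩
    push_cast; linear_combination (3 * p : ℂ) * omega_rel
  · refine ⟨_, Un_nomega, ((p - q - 1 : ℤ) : ℂ) + ((p : ℤ) : ℂ) * ω, ⟨_, _, rfl⟩, ?_⟩
    push_cast; linear_combination (3 * p : ℂ) * omega_rel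
  · refine ⟨_, Un.one_mem, ((p : ℤ) : ℂ) + ((q : ℤ) : ℂ) * ω, ⟨_, _, rfl⟩, ?_⟩
    push_cast; ring
  · refine ⟨_, Un_nsq, ((q : ℤ) : ℂ) + ((q - p : ℤ) : ℂ) * ω, ⟨_, _, rfl⟩, ?_⟩
    push_cast; linear_combination (-3 * (q - p) : ℂ) * omega_rel
  · omega
  · refine ⟨_, Un_neg, ((-p - 1 : ℤ) : ℂ) + ((-q : ℤ) : ℂ) * ω, ⟨_, _, rfl⟩, ?_⟩
    push_cast; ring
  · omega
  · refine ⟨_, Un_sq, ((-q - 1 : ℤ) : ℂ) + ((p - q : ℤ) : ℂ) * ω, ⟨_, _, rfl⟩, ?_⟩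
    push_cast; linear_combination (3 * (p - q) : ℂ) * omega_rel

/-! Gates -/
section
variable {m : ℕ}

def IsGen (M : Matrix (Fin m) (Fin m) ℂ) : Prop :=
  IsThreeLevel X3 M ∨ IsThreeLevel S3 M ∨ IsThreeLevel H3 M ∨
        IsTwoLevel !![0, 1; 1, 0] M ∨ IsOneLevel ω M ∨ IsOneLevel (-1) M

def Good (M : Matrix (Fin m) (Fin m) ℂ) : Prop :=
  M ∈ Matrix.unitaryGroup (Fin m) ℂ ∧ ∀ i j, M i j ∈ R

/-- closure of gates, with unitarity recorded -/
def K (m : ℕ) : Submonoid (Matrix (Fin m) (Fin m) ℂ) :=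
  Submonoid.closure {M | IsGen M ∧ Good M}

lemma Good.mul {A B : Matrix (Fin m) (Fin m) ℂ} (hA : Good A) (hB : Good B) : Good (A * B) := by
  refine ⟨mul_mem hA.1 hB.1, fun i j => ?_⟩
  rw [Matrix.mul_apply]
  exact R.sum_mem fun l _ => R.mul_mem (hA.2 _ _) (hB.2 _ _)

lemma Good.one : Good (1 : Matrix (Fin m) (Fin m) ℂ) := by
  refine ⟨one_mem _, fun i j => ?_⟩
  rw [Matrix.one_apply]
  split_ifs
  · exact R.one_mem
  · exact R.zero_mem

lemma Good.star {A : Matrix (Fin m) (Fin m) ℂ} (hA : Good A) : Good (star A) :=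
  ⟨Unitary.star_mem hA.1, fun i j => by
    rw [Matrix.star_apply]; exact star_R (hA.2 _ _)⟩

lemma K_good {g : Matrix (Fin m) (Fin m) ℂ} (h : g ∈ K m) : Good g := by
  refine Submonoid.closure_induction (fun x hx => hx.2) Good.one (fun x y _ _ hx hy => hx.mul hy) h

def Red (s : Finset (Fin m)) (u w : Fin m → ℂ) : Prop :=
  ∃ g ∈ K m, (∀ i ∈ s, g *ᵥ Pi.single i 1 = Pi.single i 1) ∧ u = g *ᵥ w

lemma Red.refl (s : Finset (Fin m)) (u : Fin m → ℂ) : Red s u u :=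
  ⟨1, (K m).one_mem, fun i _ => by rw [Matrix.one_mulVec], by simp⟩

lemma Red.trans {s : Finset (Fin m)} {u v w : Fin m → ℂ} (h1 : Red s u v) (h2 : Red s v w) :
    Red s u w := by
  obtain ⟨g, hg, hs, rfl⟩ := h1
  obtain ⟨g', hg', hs', rfl⟩ := h2
  refine ⟨g * g', (K m).mul_mem hg hg', fun i hi => ?_, ?_⟩
  · rw [← Matrix.mulVec_mulVec, hs' i hi, hs i hi]
  · rw [← Matrix.mulVec_mulVec]

lemma Red.smul {s : Finset (Fin m)} {u v : Fin m → ℂ} (c : ℂ) (h : Red s u v) :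
    Red s (c • u) (c • v) := by
  obtain ⟨g, hg, hs, rfl⟩ := h
  exact ⟨g, hg, hs, by rw [Matrix.mulVec_smul]⟩

lemma Red.norm {s : Finset (Fin m)} {u v : Fin m → ℂ} (h : Red s u v) :
    star u ⬝ᵥ u = star v ⬝ᵥ v := by
  obtain ⟨g, hg, hs, rfl⟩ := h
  have := (Matrix.mem_unitaryGroup_iff'.1 (K_good hg).1)
  rw [Matrix.star_mulVec, Matrix.dotProduct_mulVec, Matrix.vecMul_vecMul, ← Matrix.star_eq_conjTranspose,
    this, Matrix.vecMul_one]

section lvl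
variable {n : ℕ}

noncomputable def eqv (j : Fin n → Fin m) (hj : Function.Injective j) :
    Fin n ⊕ {i // i ∉ Set.range j} ≃ Fin m :=
  by
    classical
    exact ((Equiv.ofInjective j hj).sumCongr (Equiv.refl _)).trans (Equiv.Set.sumCompl (Set.range j))

lemma eqv_inl (j : Fin n → Fin m) (hj : Function.Injective j) (r : Fin n) :
    eqv j hj (Sum.inl r) = j r := by
  simp only [eqv, Equiv.trans_apply, Equiv.sumCongr_apply, Sum.map_inl, Sum.map_inr]
  first
    | exact Equiv.Set.sumCompl_apply_inl _ _
    | exact Equiv.Set.sumCompl_apply_inr _ _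

lemma eqv_inr (j : Fin n → Fin m) (hj : Function.Injective j) (t : {i // i ∉ Set.range j}) :
    eqv j hj (Sum.inr t) = t := by
  simp only [eqv, Equiv.trans_apply, Equiv.sumCongr_apply, Sum.map_inl, Sum.map_inr]
  first
    | exact Equiv.Set.sumCompl_apply_inl _ _
    | exact Equiv.Set.sumCompl_apply_inr _ _

lemma symm_inl (j : Fin n → Fin m) (hj : Function.Injective j) (r : Fin n) :
    (eqv j hj).symm (j r) = Sum.inl r := by
  rw [Equiv.symm_apply_eq, eqv_inl]

lemma symm_inr (j : Fin n → Fin m) (hj : Function.Injective j) (i : Fin m) (hi : i ∉ Set.range j) :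
    (eqv j hj).symm i = Sum.inr ⟨i, hi⟩ := by
  rw [Equiv.symm_apply_eq, eqv_inr]

noncomputable def lvl (j : Fin n → Fin m) (hj : Function.Injective j) (A : Matrix (Fin n) (Fin n) ℂ) :
    Matrix (Fin m) (Fin m) ℂ :=
  (Matrix.fromBlocks A 0 0 1).submatrix (eqv j hj).symm (eqv j hj).symm

lemma lvl_in (j : Fin n → Fin m) (hj : Function.Injective j) (A : Matrix (Fin n) (Fin n) ℂ) (r s) :
    lvl j hj A (j r) (j s) = A r s := by
  simp [lvl, symm_inl]

lemma lvl_out (j : Fin n → Fin m) (hj : Function.Injective j) (A : Matrix (Fin n) (Fin n) ℂ) (i i')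
    (h : i ∉ Set.range j ∨ i' ∉ Set.range j) : lvl j hj A i i' = if i = i' then 1 else 0 := by
  by_cases hi : i ∈ Set.range j <;> by_cases hi' : i' ∈ Set.range j
  · tauto
  · obtain ⟨r, rfl⟩ := hi
    have : j r ≠ i' := fun h => hi' ⟨r, h⟩
    simp [lvl, symm_inl, symm_inr _ _ _ hi', this]
  · obtain ⟨r, rfl⟩ := hi'
    have : i ≠ j r := fun h => hi ⟨r, h.symm⟩
    simp [lvl, symm_inl, symm_inr _ _ _ hi, this]
  · simp [lvl, symm_inr _ _ _ hi, symm_inr _ _ _ hi', Matrix.one_apply]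

lemma lvl_good (j : Fin n → Fin m) (hj : Function.Injective j) (A : Matrix (Fin n) (Fin n) ℂ)
    (hA : Good A) : Good (lvl j hj A) := by
  constructor
  · rw [Matrix.mem_unitaryGroup_iff]
    have := Matrix.mem_unitaryGroup_iff.1 hA.1
    rw [Matrix.star_eq_conjTranspose] at this ⊢
    rw [lvl, Matrix.conjTranspose_submatrix, Matrix.submatrix_mul_equiv, Matrix.fromBlocks_conjTranspose,
      Matrix.fromBlocks_multiply]
    simp [this]
  · intro i i'
    by_cases h : i ∉ Set.range j ∨ i' ∉ Set.range j
    · rw [lvl_out _ _ _ _ _ h]; exact Good.one.2 i i'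
    · push Not at h
      obtain ⟨⟨r, rfl⟩, ⟨s, rfl⟩⟩ := h
      rw [lvl_in]; exact hA.2 _ _

lemma lvl_red (s : Finset (Fin m)) (j : Fin n → Fin m) (hj : Function.Injective j)
    (A : Matrix (Fin n) (Fin n) ℂ) (hA : Good A) (hG : IsGen (lvl j hj A)) (hs : ∀ r, j r ∉ s)
    (v : Fin m → ℂ) (x : Fin n → ℂ) (hx : A *ᵥ x = v ∘ j) :
    ∃ w, Red s v w ∧ (∀ r, w (j r) = x r) ∧ ∀ i, i ∉ Set.range j → w i = v i := by
  refine ⟨Sum.elim x (fun t : {i // i ∉ Set.range j} => v t) ∘ (eqv j hj).symm, ⟨lvl j hj A,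
    Submonoid.subset_closure ⟨hG, lvl_good j hj A hA⟩, ?_, ?_⟩, ?_, ?_⟩
  · intro i hi
    have hi' : i ∉ Set.range j := by rintro ⟨r, rfl⟩; exact hs r hi
    ext k
    rw [Matrix.mulVec_single_one]
    simp only [Matrix.col_apply]
    rw [lvl_out _ _ _ _ _ (Or.inr hi'), Pi.single_apply]
  · rw [lvl, Matrix.submatrix_mulVec_equiv]
    ext i
    simp only [Function.comp_assoc, Equiv.symm_symm, Equiv.symm_comp_self, Function.comp_id]
    by_cases hi : i ∈ Set.range j
    · obtain ⟨r, rfl⟩ := hi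
      simp [Matrix.fromBlocks_mulVec, symm_inl, hx]
    · simp [Matrix.fromBlocks_mulVec, symm_inr _ _ _ hi]
  · intro r; simp [symm_inl]
  · intro i hi; simp [symm_inr _ _ _ hi]
end lvl

lemma one_red (s : Finset (Fin m)) (i : Fin m) (hi : i ∉ s) (a : ℂ) (ha : a = ω ∨ a = -1)
    (w : Fin m → ℂ) : Red s (Function.update w i (a * w i)) w := by
  have hj : Function.Injective (fun _ : Fin 1 => i) := fun a b _ => Subsingleton.elim _ _
  have haR : a ∈ O := by
    rcases ha with rfl | rfl
    · exact omega_O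
    · exact O.neg_mem O.one_mem
  have hn : a * star a = 1 := by
    rcases ha with rfl | rfl
    · rw [star_omega]; linear_combination -omega_rel
    · simp
  have hone : IsOneLevel a (lvl _ hj !![a]) := by
    refine ⟨i, ?_⟩
    ext k l
    by_cases h : k = i ∧ l = i
    · obtain ⟨rfl, rfl⟩ := h
      have := lvl_in _ hj !![a] 0 0
      simpa using this
    · rw [lvl_out _ hj]
      · by_cases hkl : k = l
        · subst hkl; simp at h; simp [h]
        · simp [hkl]
      · simp; tauto
  have key := lvl_red s (fun _ : Fin 1 => i) hj !![a] ?_ ?_ (fun _ => hi)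
    (Function.update w i (a * w i)) (fun _ => w i) ?_
  · obtain ⟨w', h1, h2, h3⟩ := key
    convert h1 using 1
    ext k
    by_cases hk : k = i
    · subst hk; exact (h2 0).symm
    · rw [h3 k (by simpa using hk)]; simp [hk]
  · constructor
    · rw [Matrix.mem_unitaryGroup_iff]
      ext p q
      fin_cases p; fin_cases q
      simpa [Matrix.mul_apply] using hn
    · intro p q; fin_cases p; fin_cases q; simpa using O_R haR
  · rcases ha with rfl | rfl
    · exact Or.inr (Or.inr (Or.inr (Or.inr (Or.inl hone))))
    · exact Or.inr (Or.inr (Or.inr (Or.inr (Or.inr hone))))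
  · ext p; fin_cases p; simp [Matrix.mulVec, dotProduct]

lemma unit_red' (s : Finset (Fin m)) (i : Fin m) (hi : i ∉ s) (a : ℂ) (ha : a ∈ Un) :
    ∀ (w : Fin m → ℂ), Red s (Function.update w i (a * w i)) w := by
  refine Submonoid.closure_induction (motive := fun a _ => ∀ (w : Fin m → ℂ),
    Red s (Function.update w i (a * w i)) w) ?_ ?_ ?_ ha
  · rintro x hx w
    exact one_red s i hi x (by simpa using hx) w
  · intro w; simpa using Red.refl s w
  · intro x y _ _ hx hy w
    have := (hx (Function.update w i (y * w i))).trans (hy w)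
    simpa [mul_assoc] using this

lemma swap_red (s : Finset (Fin m)) (i k : Fin m) (hi : i ∉ s) (hk : k ∉ s) :
    Red s (Pi.single i 1) (Pi.single k 1) := by
  by_cases hik : i = k
  · subst hik; exact Red.refl _ _
  have hj : Function.Injective ![i, k] := by
    intro a b h
    fin_cases a <;> fin_cases b <;> simp_all [eq_comm]
  have key := lvl_red s ![i, k] hj !![0, 1; 1, 0] ?_ ?_ ?_ (Pi.single i 1) ![0, 1] ?_
  · obtain ⟨w', h1, h2, h3⟩ := key
    convert h1 using 1
    ext l
    by_cases hl : l = i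
    · subst hl; have := h2 0; simp at this; simp [this, hik]
    by_cases hl' : l = k
    · subst hl'; have := h2 1; simp at this; simp [this]
    · rw [h3 l]
      · simp [hl, hl']
      · rintro ⟨r, hr⟩; fin_cases r <;> simp at hr <;> simp_all
  · constructor
    · rw [Matrix.mem_unitaryGroup_iff]
      ext p q
      fin_cases p <;> fin_cases q <;> simp [Matrix.mul_apply, Fin.sum_univ_two]
    · intro p q
      fin_cases p <;> fin_cases q <;> simp [R.one_mem, R.zero_mem]
  · refine Or.inr (Or.inr (Or.inr (Or.inl ⟨i, k, hik, ?_⟩)))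
    ext p q
    by_cases h : p ∉ Set.range ![i, k] ∨ q ∉ Set.range ![i, k]
    · rw [lvl_out _ _ _ _ _ h]
      simp at h
      simp only [Matrix.of_apply]
      split_ifs <;> simp_all
    · push Not at h
      obtain ⟨⟨a, rfl⟩, ⟨b, rfl⟩⟩ := h
      rw [lvl_in]
      fin_cases a <;> fin_cases b <;> simp [hik, Ne.symm hik]
  · intro r; fin_cases r <;> simp [hi, hk]
  · ext r; fin_cases r <;> simp [Matrix.mulVec, dotProduct, Fin.sum_univ_two, Ne.symm hik]

lemma H3_eq : H3 = θ⁻¹ • !![1, 1, 1; 1, ω, ω ^ 2; 1, ω ^ 2, ω] := rfl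

lemma H3_good : Good H3 := by
  rw [H3_eq]
  constructor
  · rw [Matrix.mem_unitaryGroup_iff, star_smul, Matrix.smul_mul, Matrix.mul_smul, smul_smul]
    have h1 : θ⁻¹ * star θ⁻¹ = 3⁻¹ := by
      rw [star_inv₀, star_theta, ← mul_inv, mul_neg, ← sq, theta_sq]; norm_num
    rw [h1, omega_rel]
    have hs : (starRingEnd ℂ) ω = -1 - ω := star_omega
    have hst : star !![1, 1, 1; 1, ω, -1 - ω; 1, -1 - ω, ω] =
        !![1, 1, 1; 1, -1 - ω, ω; 1, ω, -1 - ω] := by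
      ext p q
      fin_cases p <;> fin_cases q <;> simp [Matrix.star_apply, hs]
    rw [hst]
    ext p q
    fin_cases p <;> fin_cases q <;>
      simp [Matrix.mul_apply, Fin.sum_univ_three] <;> ring_nf <;>
      (try rw [omega_rel]) <;> (try ring_nf)
  · intro p q
    rw [Matrix.smul_apply, smul_eq_mul]
    refine R.mul_mem theta_inv_R (O_R ?_)
    have h2 := O.pow_mem omega_O 2
    fin_cases p <;> fin_cases q <;> simp [omega_O, h2, O.one_mem]

lemma H_red (s : Finset (Fin m)) (j : Fin 3 → Fin m) (hj : Function.Injective j) (hs : ∀ r, j r ∉ s)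
    (v : Fin m → ℂ) (t : Fin 3 → ℂ) (ht : ∀ r, t r ∈ O) (hv : ∀ r, v (j r) = 1 + 3 * t r) :
    ∃ w, Red s v w ∧ (∀ r, Dv (w (j r))) ∧ ∀ i, i ∉ Set.range j → w i = v i := by
  have h2 := O.pow_mem omega_O 2
  have key := lvl_red s j hj H3 H3_good (Or.inr (Or.inr (Or.inl
    ⟨j, hj, lvl_in j hj H3, fun i i' h => lvl_out j hj H3 i i' h⟩))) hs v
    (fun r => θ * ![1 + t 0 + t 1 + t 2, t 0 + ω ^ 2 * t 1 + ω * t 2, t 0 + ω * t 1 + ω ^ 2 * t 2] r) ?_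
  · obtain ⟨w, h1, h2, h3⟩ := key
    refine ⟨w, h1, fun r => ⟨_, ?_, h2 r⟩, h3⟩
    fin_cases r
    · exact O.add_mem (O.add_mem (O.add_mem O.one_mem (ht 0)) (ht 1)) (ht 2)
    · exact O.add_mem (O.add_mem (ht 0) (O.mul_mem ‹_› (ht 1))) (O.mul_mem omega_O (ht 2))
    · exact O.add_mem (O.add_mem (ht 0) (O.mul_mem omega_O (ht 1))) (O.mul_mem ‹_› (ht 2))
  · have h3 : ω ^ 3 = 1 := by
      have : ω ^ 3 = ω ^ 2 * ω := by ring
      rw [this, omega_rel]; linear_combination -omega_rel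
    have h4 : ω ^ 4 = ω := by rw [show ω ^ 4 = ω ^ 3 * ω by ring, h3, one_mul]
    ext r
    rw [Function.comp, hv, H3_eq]
    have := theta_ne
    fin_cases r <;> simp [Matrix.mulVec, dotProduct, Fin.sum_univ_three] <;> field_simp <;>
      ring_nf <;> (try rw [h4]) <;> (try rw [h3]) <;> rw [omega_rel] <;> ring

lemma Dv_O {z : ℂ} (h : Dv z) : z ∈ O := by
  obtain ⟨w, hw, rfl⟩ := h; exact O.mul_mem theta_O hw

/-- normalising several entries to be 1 mod 3 -/
lemma norm_red (s : Finset (Fin m)) (v : Fin m → ℂ) (hv : ∀ i, v i ∈ O) (T : Finset (Fin m))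
    (hT : ∀ i ∈ T, i ∉ s ∧ ¬ Dv (v i)) :
    ∃ w, Red s v w ∧ (∀ i ∈ T, ∃ t ∈ O, w i = 1 + 3 * t) ∧ ∀ i ∉ T, w i = v i := by
  induction T using Finset.induction_on with
  | empty => exact ⟨v, Red.refl _ _, by simp, by simp⟩
  | insert a T ha ih =>
    obtain ⟨w, h1, h2, h3⟩ := ih (fun i hi => hT i (Finset.mem_insert_of_mem hi))
    obtain ⟨ha1, ha2⟩ := hT a (Finset.mem_insert_self _ _)
    obtain ⟨u, hu, t, ht, he⟩ := unit_red (hv a) ha2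
    refine ⟨Function.update w a (1 + 3 * t), h1.trans ?_, ?_, ?_⟩
    · have := unit_red' s a ha1 u hu (Function.update w a (1 + 3 * t))
      simp only [Function.update_self, Function.update_idem] at this
      rw [← he, ← h3 a ha, Function.update_eq_self] at this
      exact this
    · intro i hi
      by_cases hia : i = a
      · subst hia; exact ⟨t, ht, by simp⟩
      · rw [Function.update_of_ne hia]
        exact h2 i (Finset.mem_of_mem_insert_of_ne hi hia)
    · intro i hi
      rw [Finset.mem_insert, not_or] at hi
      rw [Function.update_of_ne hi.1, h3 i hi.2]

lemma Dv_zero : Dv 0 := ⟨0, O.zero_mem, by simp⟩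

lemma red_zero (s : Finset (Fin m)) (j : Fin m) (hj : j ∉ s) (v : Fin m → ℂ)
    (hv : ∀ i, v i ∈ O) (hs : ∀ i ∈ s, v i = 0) (hn : star v ⬝ᵥ v = 1) :
    Red s v (Pi.single j 1) := by
  choose n h1 h2 h3 h4 _ _ using fun i => norm_facts (hv i)
  have hsum : ∑ i, n i = 1 := by
    have : ∑ i, (n i : ℂ) = 1 := by
      rw [← hn]; exact Finset.sum_congr rfl fun i _ => (h1 i).symm
    exact_mod_cast this
  obtain ⟨i, -, hi⟩ : ∃ i ∈ Finset.univ, n i ≠ 0 := by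
    apply Finset.exists_ne_zero_of_sum_ne_zero
    rw [hsum]; norm_num
  have hi1 : 1 ≤ n i := by have := h2 i; omega
  have hsplit := Finset.add_sum_erase Finset.univ n (Finset.mem_univ i)
  have hnn : 0 ≤ ∑ k ∈ Finset.univ.erase i, n k := Finset.sum_nonneg fun k _ => h2 k
  have hi2 : n i = 1 := by omega
  have hz : ∑ k ∈ Finset.univ.erase i, n k = 0 := by omega
  rw [Finset.sum_eq_zero_iff_of_nonneg (fun k _ => h2 k)] at hz
  have his : i ∉ s := by
    intro h
    have := h1 i
    rw [hs i h, hi2] at this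
    simp at this
  have hve : v = Function.update (Pi.single i 1) i (v i * (Pi.single i 1 : Fin m → ℂ) i) := by
    ext k
    by_cases hk : k = i
    · subst hk; simp
    · simp [hk, h3 k (hz k (by simp [hk]))]
  have := unit_red' s i his (v i) (h4 i hi2) (Pi.single i 1)
  rw [← hve] at this
  exact this.trans (swap_red s i j his hj)

lemma not_Dv_one {t : ℂ} (ht : t ∈ O) : (1 + 3 * t) ∈ O :=
  O.add_mem O.one_mem (O.mul_mem (ofNat_mem O 3) ht)

open Classical in
lemma red_main (s : Finset (Fin m)) (j : Fin m) (hj : j ∉ s) (k : ℕ) : ∀ (v : Fin m → ℂ),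
    (∀ i, v i ∈ O) → (∀ i ∈ s, v i = 0) → star v ⬝ᵥ v = 3 ^ k →
    Red s ((θ ^ k)⁻¹ • v) (Pi.single j 1) := by
  induction k with
  | zero =>
    intro v hv hs hn
    simpa using red_zero s j hj v hv hs (by simpa using hn)
  | succ k ihk =>
    suffices H : ∀ (N : ℕ) (v : Fin m → ℂ), (∀ i, v i ∈ O) → (∀ i ∈ s, v i = 0) →
        star v ⬝ᵥ v = 3 ^ (k + 1) → (Finset.univ.filter (fun i => ¬ Dv (v i))).card = N →
        Red s ((θ ^ (k + 1))⁻¹ • v) (Pi.single j 1) from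
      fun v hv hs hn => H _ v hv hs hn rfl
    intro N
    induction N using Nat.strong_induction_on with
    | _ N ih =>
    intro v hv hs hn hN
    by_cases hall : ∀ i, Dv (v i)
    · choose w hw hvw using hall
      have hvw' : v = θ • w := by ext i; simp [hvw]
      have e : (θ ^ (k + 1))⁻¹ • v = (θ ^ k)⁻¹ • w := by
        rw [hvw', smul_smul, pow_succ, mul_inv, mul_assoc, inv_mul_cancel₀ theta_ne, mul_one]
      rw [e]
      refine ihk w hw ?_ ?_
      · intro i hi
        have := hs i hi
        rw [hvw i] at this
        exact (mul_eq_zero.1 this).resolve_left theta_ne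
      · rw [hvw', star_smul, smul_dotProduct, dotProduct_smul, smul_smul, star_theta, smul_eq_mul,
          neg_mul, ← sq, theta_sq] at hn
        have : (3 : ℂ) * (star w ⬝ᵥ w) = 3 * 3 ^ k := by rw [pow_succ] at hn; linear_combination hn
        exact mul_left_cancel₀ (by norm_num) this
    · have h3N : 3 ∣ N := by
        choose n h1 _ _ _ h5 h6 using fun i => norm_facts (hv i)
        have hsum : ∑ i, n i = 3 ^ (k + 1) := by
          have : ∑ i, (n i : ℂ) = 3 ^ (k + 1) := by
            rw [← hn]; exact Finset.sum_congr rfl fun i _ => (h1 i).symm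
          exact_mod_cast this
        have hz : ((∑ i, n i : ℤ) : ZMod 3) = 0 := by
          rw [hsum, pow_succ]; push_cast
          rw [show (3 : ZMod 3) = 0 from rfl]; simp
        have hc : ((∑ i, n i : ℤ) : ZMod 3) = (N : ZMod 3) := by
          rw [← hN, Finset.card_filter]
          push_cast
          refine Finset.sum_congr rfl fun i _ => ?_
          split_ifs with h
          · exact h5 i h
          · exact h6 i h
        rw [hc] at hz
        exact (ZMod.natCast_eq_zero_iff N 3).1 hz
      have hpos : 0 < N := by
        push Not at hall
        obtain ⟨i, hi⟩ := hall
        rw [← hN]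
        exact Finset.card_pos.2 ⟨i, by simp [hi]⟩
      have h3 : 3 ≤ (Finset.univ.filter (fun i => ¬ Dv (v i))).card := by
        rw [hN]; exact Nat.le_of_dvd hpos h3N
      obtain ⟨T, hT, hTc⟩ := Finset.exists_subset_card_eq h3
      have hTb : ∀ i ∈ T, i ∉ s ∧ ¬ Dv (v i) := by
        intro i hi
        have h := (Finset.mem_filter.1 (hT hi)).2
        exact ⟨fun his => h (by rw [hs i his]; exact Dv_zero), h⟩
      obtain ⟨w, hw1, hw2, hw3⟩ := norm_red s v hv T hTb
      let f : Fin 3 → Fin m := fun r => T.equivFin.symm (Fin.cast hTc.symm r)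
      have hfi : Function.Injective f := by
        intro a b h
        have := T.equivFin.symm.injective (Subtype.ext h)
        simpa using this
      have hfT : ∀ r, f r ∈ T := fun r => (T.equivFin.symm _).2
      have hrange : ∀ i, i ∈ T → i ∈ Set.range f := by
        intro i hi
        refine ⟨Fin.cast hTc (T.equivFin ⟨i, hi⟩), ?_⟩
        simp [f]
      choose t ht1 ht2 using fun r => hw2 (f r) (hfT r)
      obtain ⟨x, hx1, hx2, hx3⟩ := H_red s f hfi (fun r => (hTb _ (hfT r)).1) w t ht1 ht2
      have hred := hw1.trans hx1
      have hxT : ∀ i ∈ T, Dv (x i) := by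
        intro i hi
        obtain ⟨r, rfl⟩ := hrange i hi
        exact hx2 r
      have hxnT : ∀ i, i ∉ T → x i = v i := by
        intro i hi
        rw [hx3 i (by rintro ⟨r, rfl⟩; exact hi (hfT r)), hw3 i hi]
      refine (hred.smul _).trans (ih _ ?_ x ?_ ?_ (hred.norm ▸ hn) rfl)
      · rw [← hN]
        apply Finset.card_lt_card
        rw [Finset.ssubset_iff_of_subset]
        · exact ⟨f 0, hT (hfT 0), by simp [hx2 0]⟩
        · intro i hi
          rw [Finset.mem_filter] at hi ⊢
          refine ⟨hi.1, ?_⟩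
          have : i ∉ T := fun h => hi.2 (hxT i h)
          rw [← hxnT i this]; exact hi.2
      · intro i
        by_cases hi : i ∈ T
        · exact Dv_O (hxT i hi)
        · rw [hxnT i hi]; exact hv i
      · intro i hi
        rw [hxnT i (fun h => (hTb i h).1 hi)]; exact hs i hi

lemma red_unit (s : Finset (Fin m)) (j : Fin m) (hj : j ∉ s) (u : Fin m → ℂ)
    (hu : ∀ i, u i ∈ R) (hs : ∀ i ∈ s, u i = 0) (hn : star u ⬝ᵥ u = 1) :
    Red s u (Pi.single j 1) := by
  choose k hk using hu
  set L := ∑ i, k i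
  have hL : ∀ i, θ ^ L * u i ∈ O := fun i =>
    pow_up (hk i) (Finset.single_le_sum (f := k) (fun _ _ => Nat.zero_le _) (Finset.mem_univ i))
  have := red_main s j hj L (θ ^ L • u) hL (fun i hi => by simp [hs i hi]) ?_
  · rwa [smul_smul, inv_mul_cancel₀ (pow_ne_zero _ theta_ne), one_smul] at this
  · rw [star_smul, smul_dotProduct, dotProduct_smul, smul_smul, hn, star_pow, star_theta,
      ← mul_pow, neg_mul, ← sq, theta_sq]
    simp

lemma main (c : ℕ) : ∀ (s : Finset (Fin m)) (U : Matrix (Fin m) (Fin m) ℂ), sᶜ.card = c → Good U →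
    (∀ i ∈ s, U *ᵥ Pi.single i 1 = Pi.single i 1) → U ∈ K m := by
  induction c with
  | zero =>
    intro s U hc hU hs
    have : U = 1 := by
      apply Matrix.ext_of_mulVec_single
      intro i
      rw [hs i, Matrix.one_mulVec]
      rw [Finset.card_eq_zero, Finset.compl_eq_empty_iff] at hc
      simp [hc]
    rw [this]; exact (K m).one_mem
  | succ c ih =>
    intro s U hc hU hs
    obtain ⟨j, hj⟩ : sᶜ.Nonempty := Finset.card_pos.1 (by omega)
    have hjs : j ∉ s := Finset.mem_compl.1 hj
    have hUU := Matrix.mem_unitaryGroup_iff'.1 hU.1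
    have hdot : ∀ i l, star (U *ᵥ Pi.single i 1) ⬝ᵥ (U *ᵥ Pi.single l 1) =
        (1 : Matrix (Fin m) (Fin m) ℂ) i l := by
      intro i l
      rw [← hUU, Matrix.mul_apply]
      simp [dotProduct, Matrix.star_apply]
    have key := red_unit s j hjs (U *ᵥ Pi.single j 1) ?_ ?_ ?_
    · obtain ⟨g, hg, hgs, hgu⟩ := key
      have hgg := Matrix.mem_unitaryGroup_iff'.1 (K_good hg).1
      have hgg' := Matrix.mem_unitaryGroup_iff.1 (K_good hg).1
      have hU' : star g * U ∈ K m := by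
        refine ih (insert j s) (star g * U) ?_ ((K_good hg).star.mul hU) ?_
        · rw [Finset.compl_insert, Finset.card_erase_of_mem hj, hc]; rfl
        · intro i hi
          rw [← Matrix.mulVec_mulVec]
          rcases Finset.mem_insert.1 hi with rfl | hi
          · rw [hgu, Matrix.mulVec_mulVec, hgg, Matrix.one_mulVec]
          · rw [hs i hi]
            conv_lhs => rw [← hgs i hi]
            rw [Matrix.mulVec_mulVec, hgg, Matrix.one_mulVec]
      have := (K m).mul_mem hg hU'
      rwa [← mul_assoc, hgg', one_mul] at this
    · intro i
      rw [Matrix.mulVec_single_one]; exact hU.2 _ _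
    · intro i hi
      have := hdot i j
      rw [hs i hi, Matrix.one_apply_ne (by rintro rfl; exact hjs hi)] at this
      rw [← this]
      simp [dotProduct, Pi.single_apply, apply_ite]
    · rw [hdot, Matrix.one_apply_eq]

end
end QD

/-- Every `m×m` unitary matrix with entries in `ℤ[1/3, ω]` is a finite
product of `m×m` matrices, each of which is a 3-level matrix of type `X`, `S` or `H`, a
2-level matrix of type `[[0,1],[1,0]]`, or a 1-level matrix of type `ω` or `−1`. -/
theorem unitary_decomposition_into_level_matrices
    (m : ℕ) (hm : 1 ≤ m)
    (U : Matrix (Fin m) (Fin m) ℂ) (hU : U ∈ Matrix.unitaryGroup (Fin m) ℂ)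
    (hent : ∀ i j, U i j ∈ Subring.closure {(3 : ℂ)⁻¹, ω}) :
    ∃ Us : List (Matrix (Fin m) (Fin m) ℂ),
      (∀ M ∈ Us, IsThreeLevel X3 M ∨ IsThreeLevel S3 M ∨ IsThreeLevel H3 M ∨
        IsTwoLevel !![0, 1; 1, 0] M ∨ IsOneLevel ω M ∨ IsOneLevel (-1) M) ∧
      U = Us.prod := by
  have h := QD.main _ ∅ U rfl ⟨hU, fun i j => QD.closure_R (hent i j)⟩ (by simp)
  obtain ⟨l, hl, rfl⟩ := Submonoid.exists_list_of_mem_closure h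
  exact ⟨l, fun M hM => (hl M hM).1, rfl⟩
end

section
/- Let n ≥ 2, let U ∈ M₃(ℂ) be unitary with entries in ℤ[1/3, ω], and let M be an m×m unitary 3-level matrix of type U with 3^{n−1} < m ≤ 3^n; set m' = 3^n − m. Then the 3^n × 3^n unitary matrix I_{m'} ⊕ M is a finite product of n-qutrit gates, each of which is either a multiply-controlled gate Λ^j_c(X) or Λ^j_c(H) (an (n−1)-controlled X or H on some target wire j with some control word c ∈ {0,1,2}^{n−1}), or a single multiply-controlled gate Λ^j_c(P^{-1} U P) for some 3×3 permutation matrix P, some target wire j, and some control word c. -/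
/-- The multiply-controlled gate `Λ^j_c(V)` on `n` qutrits (with state space `(ℂ³)^{⊗n}`,
whose standard basis is indexed by words `x : Fin n → Fin 3`): it applies `V` to wire `j`
on those basis vectors whose letters away from wire `j` agree with the control word `c`
(only the values of `c` away from `j` are relevant), and fixes all other basis vectors. -/
def ctrlGate (n : ℕ) (V : Matrix (Fin 3) (Fin 3) ℂ) (j : Fin n) (c : Fin n → Fin 3) :
    Matrix (Fin n → Fin 3) (Fin n → Fin 3) ℂ :=
  Matrix.of fun x y =>
    if ∀ i, i ≠ j → x i = c i then
      (if ∀ i, i ≠ j → y i = c i then V (x j) (y j) else 0)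
    else (if x = y then 1 else 0)

/-- The lexicographic identification of the standard basis of `ℂ^{3^n}` with the words
`(x₁, …, x_n) ∈ {0,1,2}^n` (with `x₁` most significant). -/
def lexEquiv (n : ℕ) : (Fin n → Fin 3) ≃ Fin (3 ^ n) :=
  (Equiv.arrowCongr Fin.revPerm (Equiv.refl (Fin 3))).trans finFunctionFinEquiv

def lineFun (n : ℕ) (j : Fin n) (c : Fin n → Fin 3) (x : Fin n → Fin 3) : Fin n → Fin 3 :=
  if ∀ i, i ≠ j → x i = c i then Function.update x j (x j + 1) else x

theorem fin3_add (a : Fin 3) : a + 1 + 1 + 1 = a := by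
  revert a; decide

theorem lineFun_on {n : ℕ} {j : Fin n} {c x : Fin n → Fin 3} (h : ∀ i, i ≠ j → x i = c i) :
    lineFun n j c x = Function.update x j (x j + 1) := if_pos h

theorem lineFun_off {n : ℕ} {j : Fin n} {c x : Fin n → Fin 3} (h : ¬ ∀ i, i ≠ j → x i = c i) :
    lineFun n j c x = x := if_neg h

theorem upd_line {n : ℕ} {j : Fin n} {c x : Fin n → Fin 3} (h : ∀ i, i ≠ j → x i = c i)
    (a : Fin 3) : ∀ i, i ≠ j → (Function.update x j a) i = c i := by
  intro i hi
  rw [Function.update_of_ne hi]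
  exact h i hi

theorem lineFun_three {n : ℕ} (j : Fin n) (c x : Fin n → Fin 3) :
    lineFun n j c (lineFun n j c (lineFun n j c x)) = x := by
  by_cases h : ∀ i, i ≠ j → x i = c i
  · rw [lineFun_on h, lineFun_on (upd_line h _), Function.update_idem,
      lineFun_on (upd_line h _), Function.update_idem]
    simp [fin3_add]
  · rw [lineFun_off h, lineFun_off h, lineFun_off h]

def lineCyc (n : ℕ) (j : Fin n) (c : Fin n → Fin 3) : Equiv.Perm (Fin n → Fin 3) where
  toFun := lineFun n j c
  invFun x := lineFun n j c (lineFun n j c x)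
  left_inv := lineFun_three j c
  right_inv := lineFun_three j c

theorem lineCyc_apply {n : ℕ} (j : Fin n) (c x : Fin n → Fin 3) :
    lineCyc n j c x = lineFun n j c x := rfl

theorem lineCyc_inv {n : ℕ} (j : Fin n) (c : Fin n → Fin 3) :
    (lineCyc n j c)⁻¹ = lineCyc n j c * lineCyc n j c := by
  ext1 x
  rfl

theorem on_line_eq {n : ℕ} {j : Fin n} {c x : Fin n → Fin 3} (h : ∀ i, i ≠ j → x i = c i) :
    x = Function.update c j (x j) := by
  funext i
  by_cases hi : i = j
  · subst hi; simp
  · rw [Function.update_of_ne hi]; exact h i hi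

theorem lineCyc_three {n : ℕ} (j : Fin n) (c : Fin n → Fin 3) :
    (lineCyc n j c).IsThreeCycle := by
  rw [← card_support_eq_three_iff]
  have : (lineCyc n j c).support = Finset.univ.image (fun a : Fin 3 => Function.update c j a) := by
    ext x
    rw [Equiv.Perm.mem_support, lineCyc_apply, Finset.mem_image]
    by_cases h : ∀ i, i ≠ j → x i = c i
    · rw [lineFun_on h]
      refine iff_of_true ?_ ⟨x j, Finset.mem_univ _, (on_line_eq h).symm⟩
      intro h2
      have := congrFun h2 j
      simp at this
    · rw [lineFun_off h]
      refine iff_of_false (fun h => h rfl) ?_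
      rintro ⟨a, -, rfl⟩
      exact h (upd_line (fun _ _ => rfl) a)
  rw [this, Finset.card_image_of_injective _ (Function.update_injective c j)]
  simp

theorem closed_univ {n : ℕ} (B : Set (Fin n → Fin 3)) (hne : B.Nonempty)
    (h : ∀ j c, ∀ x ∈ B, lineCyc n j c x ∈ B) : B = Set.univ := by
  have step : ∀ j, ∀ x ∈ B, ∀ a, Function.update x j a ∈ B := by
    intro j x hx a
    have h1 := h j x x hx
    have h2 := h j x _ h1
    simp only [lineCyc_apply] at h1 h2
    rw [lineFun_on (fun _ _ => rfl)] at h1 h2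
    rw [lineFun_on (upd_line (fun _ _ => rfl) _), Function.update_idem, Function.update_self] at h2
    have key : ∀ b a : Fin 3, a = b ∨ a = b + 1 ∨ a = b + 1 + 1 := by decide
    rcases key (x j) a with e | e | e
    · rw [e, Function.update_eq_self]; exact hx
    · rw [e]; exact h1
    · rw [e]; exact h2
  obtain ⟨x, hx⟩ := hne
  ext y
  refine iff_of_true ?_ trivial
  have : ∀ s : Finset (Fin n), s.piecewise y x ∈ B := by
    intro s
    induction s using Finset.induction_on with
    | empty => simpa using hx
    | insert i s hi ih =>
      rw [Finset.piecewise_insert]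
      exact step i _ ih _
  simpa using this Finset.univ

def lineGrp (n : ℕ) : Subgroup (Equiv.Perm (Fin n → Fin 3)) :=
  Subgroup.closure {g | ∃ j c, g = lineCyc n j c}

theorem lineCyc_mem {n : ℕ} (j : Fin n) (c : Fin n → Fin 3) : lineCyc n j c ∈ lineGrp n :=
  Subgroup.subset_closure ⟨j, c, rfl⟩

open scoped Pointwise in
theorem lineGrp_prim {n : ℕ} (hn : 2 ≤ n) : MulAction.IsPreprimitive (lineGrp n) (Fin n → Fin 3) := by
  have j0 : Fin n := ⟨0, by omega⟩
  refine MulAction.IsPreprimitive.of_isTrivialBlock_of_notMem_fixedPoints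
    (a := fun _ => (0 : Fin 3)) ?_ ?_
  · intro h
    have := h ⟨lineCyc n j0 (fun _ => 0), lineCyc_mem _ _⟩
    have h2 : lineCyc n j0 (fun _ => 0) (fun _ => 0) = (fun _ => (0 : Fin 3)) := this
    rw [lineCyc_apply, lineFun_on (fun _ _ => rfl)] at h2
    have := congrFun h2 j0
    simp at this
  · intro B h0 hB
    by_cases hs : B.Subsingleton
    · exact Or.inl hs
    right
    refine closed_univ B ⟨_, h0⟩ ?_
    intro j c x hx
    obtain ⟨w, hw, hwx⟩ : ∃ w ∈ B, w ≠ x := by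
      by_contra hcon
      push Not at hcon
      exact hs fun a ha b hb => (hcon a ha).trans (hcon b hb).symm
    set g : lineGrp n := ⟨lineCyc n j c, lineCyc_mem _ _⟩ with hg
    have hgs : ∀ y, g • y = lineCyc n j c y := fun y => rfl
    have hgB : ∀ y ∈ B, g • y ∈ B → g • B = B := by
      intro y hy hgy
      exact hB.smul_eq_of_nonempty ⟨g • y, Set.smul_mem_smul_set hy, hgy⟩
    have : g • B = B := by
      by_cases hxl : ∀ i, i ≠ j → x i = c i
      · by_cases hwl : ∀ i, i ≠ j → w i = c i
        · have key : ∀ b a : Fin 3, a = b ∨ a = b + 1 ∨ b = a + 1 := by decide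
          rcases key (x j) (w j) with e | e | e
          · exact absurd (by rw [on_line_eq hwl, e, ← on_line_eq hxl]) hwx
          · refine hgB x hx ?_
            have : g • x = w := by
              rw [hgs, lineCyc_apply, lineFun_on hxl, ← e, on_line_eq hxl]
              simp [← on_line_eq hwl]
            rwa [this]
          · refine hgB w hw ?_
            have : g • w = x := by
              rw [hgs, lineCyc_apply, lineFun_on hwl, ← e, on_line_eq hwl]
              simp [← on_line_eq hxl]
            rwa [this]
        · refine hgB w hw ?_
          rw [hgs, lineCyc_apply, lineFun_off hwl]; exact hw
      · refine hgB x hx ?_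
        rw [hgs, lineCyc_apply, lineFun_off hxl]; exact hx
    rw [← hgs, ← this]
    exact Set.smul_mem_smul_set hx

theorem three_trans {n : ℕ} (hn : 2 ≤ n) (p q : Fin 3 ↪ (Fin n → Fin 3)) :
    ∃ g ∈ lineGrp n, ∀ r, g (p r) = q r := by
  have hle := Equiv.Perm.alternatingGroup_le_of_isPreprimitive_of_isThreeCycle_mem
    (lineGrp_prim hn) (lineCyc_three ⟨0, by omega⟩ (fun _ => 0)) (lineCyc_mem _ _)
  have hcard : 9 ≤ Nat.card (Fin n → Fin 3) := by
    rw [Nat.card_eq_fintype_card]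
    simp only [Fintype.card_pi, Fintype.card_fin, Finset.prod_const, Finset.card_univ]
    calc 9 = 3 ^ 2 := by norm_num
      _ ≤ 3 ^ n := Nat.pow_le_pow_right (by norm_num) hn
  have h1 := alternatingGroup.isMultiplyPretransitive (Fin n → Fin 3)
  have h2 : MulAction.IsMultiplyPretransitive (alternatingGroup (Fin n → Fin 3))
      (Fin n → Fin 3) 3 :=
    MulAction.isMultiplyPretransitive_of_le (n := Nat.card (Fin n → Fin 3) - 2) (by omega) (by omega)
  obtain ⟨g, hg⟩ := (MulAction.isMultiplyPretransitive_iff).1 h2 p q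
  refine ⟨g, hle g.2, fun r => ?_⟩
  rw [← hg]
  rfl

def toMat {n : ℕ} (f : Equiv.Perm (Fin n → Fin 3)) : Matrix (Fin n → Fin 3) (Fin n → Fin 3) ℂ :=
  Matrix.of fun x y => if x = f y then 1 else 0

theorem toMat_mul {n : ℕ} (f g : Equiv.Perm (Fin n → Fin 3)) :
    toMat (f * g) = toMat f * toMat g := by
  ext x y
  simp [toMat, Matrix.mul_apply]
  congr

theorem toMat_one {n : ℕ} : toMat (1 : Equiv.Perm (Fin n → Fin 3)) = 1 := by
  ext x y
  simp [toMat, Matrix.one_apply]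
  congr

theorem toMat_conj {n : ℕ} (f : Equiv.Perm (Fin n → Fin 3))
    (A : Matrix (Fin n → Fin 3) (Fin n → Fin 3) ℂ) (x y : Fin n → Fin 3) :
    (toMat f * A * toMat f⁻¹) (f x) (f y) = A x y := by
  simp [toMat, Matrix.mul_apply]

theorem toMat_lineCyc {n : ℕ} (j : Fin n) (c : Fin n → Fin 3) :
    toMat (lineCyc n j c) = ctrlGate n X3 j c := by
  have hX : ∀ a b : Fin 3, X3 a b = if a = b + 1 then 1 else 0 := by
    intro a b
    fin_cases a <;> fin_cases b <;> simp [X3]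
  ext x y
  simp only [toMat, ctrlGate, Matrix.of_apply]
  by_cases hy : ∀ i, i ≠ j → y i = c i
  · have hv := lineFun_on hy
    rw [← lineCyc_apply] at hv
    generalize lineCyc n j c y = z at hv ⊢
    subst hv
    by_cases hx : ∀ i, i ≠ j → x i = c i
    · rw [if_pos hx, if_pos hy, hX]
      congr 1
      apply propext
      constructor
      · intro h; rw [h]; simp
      · intro h
        rw [on_line_eq hx, on_line_eq hy, h]; simp
    · have h1 : x ≠ Function.update y j (y j + 1) := by
        rintro rfl; exact hx (upd_line hy _)
      have h2 : x ≠ y := by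
        rintro rfl; exact hx hy
      rw [if_neg hx, if_neg h1, if_neg h2]
  · have hv := lineFun_off hy
    rw [← lineCyc_apply] at hv
    generalize lineCyc n j c y = z at hv ⊢
    subst hv
    by_cases hx : ∀ i, i ≠ j → x i = c i
    · have h2 : x ≠ z := by
        rintro rfl; exact hy hx
      rw [if_pos hx, if_neg hy, if_neg h2]
    · rw [if_neg hx]

theorem grp_list {n : ℕ} (g : Equiv.Perm (Fin n → Fin 3)) (hg : g ∈ lineGrp n) :
    ∃ A : List (Matrix (Fin n → Fin 3) (Fin n → Fin 3) ℂ),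
      (∀ G ∈ A, ∃ j c, G = ctrlGate n X3 j c) ∧ A.prod = toMat g := by
  induction hg using Subgroup.closure_induction'' with
  | one => exact ⟨[], by simp, by simp [toMat_one]⟩
  | mem x hx =>
    obtain ⟨j, c, rfl⟩ := hx
    exact ⟨[ctrlGate n X3 j c], by simp, by simp [toMat_lineCyc]⟩
  | inv_mem x hx =>
    obtain ⟨j, c, rfl⟩ := hx
    exact ⟨[ctrlGate n X3 j c, ctrlGate n X3 j c], by simp,
      by simp [lineCyc_inv, toMat_mul, toMat_lineCyc]⟩
  | mul x y _ _ hx hy =>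
    obtain ⟨A, hA, hA'⟩ := hx
    obtain ⟨B, hB, hB'⟩ := hy
    refine ⟨A ++ B, ?_, by rw [List.prod_append, hA', hB', toMat_mul]⟩
    intro G hG
    rcases List.mem_append.1 hG with h | h
    exacts [hA G h, hB G h]

/-- Let `n ≥ 2`, let `U ∈ M₃(ℂ)` be unitary with entries in `ℤ[1/3, ω]`,
and let `M` be an `m×m` unitary 3-level matrix of type `U` with `3^{n-1} < m ≤ 3^n`,
`m' = 3^n − m`.  Then `I_{m'} ⊕ M`, viewed as an `n`-qutrit unitary via the lexicographic
identification, is a finite product of multiply-controlled gates `Λ^{j'}_{c'}(X)` and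
`Λ^{j'}_{c'}(H)` together with a single multiply-controlled gate `Λ^j_c(P⁻¹UP)` for some
`3×3` permutation matrix `P`. -/
theorem three_level_to_controlled
    (n : ℕ) (hn : 2 ≤ n)
    (U : Matrix (Fin 3) (Fin 3) ℂ) (hU : U ∈ Matrix.unitaryGroup (Fin 3) ℂ)
    (hent : ∀ i j, U i j ∈ Subring.closure {(3 : ℂ)⁻¹, ω})
    (m m' : ℕ) (hm1 : 3 ^ (n - 1) < m) (hm2 : m ≤ 3 ^ n) (hm' : m' = 3 ^ n - m)
    (M : Matrix (Fin m) (Fin m) ℂ) (hM : M ∈ Matrix.unitaryGroup (Fin m) ℂ)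
    (h3 : IsThreeLevel U M)
    (e : (Fin m' ⊕ Fin m) ≃ (Fin n → Fin 3))
    (he : e = (finSumFinEquiv.trans
      (finCongr (by rw [hm']; exact Nat.sub_add_cancel hm2))).trans (lexEquiv n).symm) :
    ∃ (A B : List (Matrix (Fin n → Fin 3) (Fin n → Fin 3) ℂ))
      (σ : Equiv.Perm (Fin 3)) (j : Fin n) (c : Fin n → Fin 3),
      (∀ G ∈ A ++ B, ∃ (j' : Fin n) (c' : Fin n → Fin 3),
        G = ctrlGate n X3 j' c' ∨ G = ctrlGate n H3 j' c') ∧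
      Matrix.reindex e e (Matrix.fromBlocks 1 0 0 M) =
        A.prod * ctrlGate n ((σ.permMatrix ℂ)⁻¹ * U * σ.permMatrix ℂ) j c * B.prod := by
  obtain ⟨k, hk, hkU, hkO⟩ := h3
  set D := Matrix.reindex e e (Matrix.fromBlocks 1 0 0 M) with hD
  let j0 : Fin n := ⟨0, by omega⟩
  let c0 : Fin n → Fin 3 := fun _ => 0
  let p : Fin 3 ↪ (Fin n → Fin 3) := ⟨fun a => Function.update c0 j0 a, Function.update_injective c0 j0⟩
  let q : Fin 3 ↪ (Fin n → Fin 3) := ⟨fun a => e (Sum.inr (k a)),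
    e.injective.comp (Sum.inr_injective.comp hk)⟩
  obtain ⟨g, hg, hgp⟩ := three_trans hn p q
  obtain ⟨A, hA, hA'⟩ := grp_list g hg
  obtain ⟨B, hB, hB'⟩ := grp_list g⁻¹ (inv_mem hg)
  have D1 : ∀ r s, D (q r) (q s) = U r s := by
    intro r s
    simp [hD, q, hkU]
  have D2 : ∀ x y, ((¬ ∃ r, q r = x) ∨ (¬ ∃ s, q s = y)) → D x y = if x = y then 1 else 0 := by
    intro x y h
    obtain ⟨x, rfl⟩ := e.surjective x
    obtain ⟨y, rfl⟩ := e.surjective y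
    simp only [hD, Matrix.reindex_apply, Matrix.submatrix_apply, Equiv.symm_apply_apply,
      EmbeddingLike.apply_eq_iff_eq]
    rcases x with x | x <;> rcases y with y | y
    · simp [Matrix.one_apply]
    · simp
    · simp
    · rw [Matrix.fromBlocks_apply₂₂, hkO x y (by simpa [q] using h)]
      simp
  have pl : ∀ x : Fin n → Fin 3, (∀ i, i ≠ j0 → x i = c0 i) → g x = q (x j0) := by
    intro x hx
    rw [← hgp]
    exact congrArg g (on_line_eq hx)
  have pn : ∀ x : Fin n → Fin 3, (¬ ∀ i, i ≠ j0 → x i = c0 i) → ¬ ∃ r, q r = g x := by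
    rintro x hx ⟨r, hr⟩
    rw [← hgp] at hr
    rw [← g.injective hr] at hx
    exact hx (upd_line (fun _ _ => rfl) r)
  refine ⟨A, B, 1, j0, c0, ?_, ?_⟩
  · intro G hG
    rcases List.mem_append.1 hG with h | h
    · obtain ⟨j, c, h⟩ := hA G h
      exact ⟨j, c, Or.inl h⟩
    · obtain ⟨j, c, h⟩ := hB G h
      exact ⟨j, c, Or.inl h⟩
  · have hone : ((1 : Equiv.Perm (Fin 3)).permMatrix ℂ) = 1 := Matrix.permMatrix_one
    rw [hA', hB', hone, inv_one, one_mul, mul_one]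
    ext x y
    obtain ⟨x, rfl⟩ := g.surjective x
    obtain ⟨y, rfl⟩ := g.surjective y
    rw [toMat_conj]
    simp only [ctrlGate, Matrix.of_apply]
    by_cases hx : ∀ i, i ≠ j0 → x i = c0 i
    · by_cases hy : ∀ i, i ≠ j0 → y i = c0 i
      · rw [if_pos hx, if_pos hy, pl x hx, pl y hy, D1]
      · rw [if_pos hx, if_neg hy, D2 _ _ (Or.inr (pn y hy)), if_neg]
        intro h
        exact hy (g.injective h ▸ hx)
    · rw [if_neg hx, D2 _ _ (Or.inl (pn x hx))]
      simp
end
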